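/- arXiv:2202.07124 — 3 statements merged into one kernel-verified Lean document; each statement's English description precedes it below -/
import Mathlib

section
/- Let (X,ρ,μ) be a quasi-metric space equipped with a nonnegative Borel measure such that all ρ-balls are μ-measurable, let s,p ∈ (0,∞) and q ∈ (0,∞], and suppose ϱ is a quasi-metric on X equivalent to ρ (c^{−1} ϱ ≤ ρ ≤ c ϱ pointwise for some c ≥ 1) such that all ϱ-balls are μ-measurable. Then Ṁ^s_{p,q}(X,ρ,μ) = Ṁ^s_{p,q}(X,ϱ,μ) and Ṅ^s_{p,q}(X,ρ,μ) = Ṅ^s_{p,q}(X,ϱ,μ) as sets, with equivalent (quasi-)norms; consequently M^s_{p,q}(X,ρ,μ) = M^s_{p,q}(X,ϱ,μ) and N^s_{p,q}(X,ρ,μ) = N^s_{p,q}(X,ϱ,μ) as sets, with equivalent (quasi-)norms. -/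
open MeasureTheory ENNReal Set

noncomputable section

namespace HajlaszPaper

variable {X : Type*}

/-- The `ρ`-ball centered at `x` with radius `r`. -/
def qball (ρ : X → X → ℝ) (x : X) (r : ℝ) : Set X := {y | ρ x y < r}

/-- `ρ` is a quasi-metric on `X`. -/
def IsQuasiDist (ρ : X → X → ℝ) : Prop :=
  (∀ x y, 0 ≤ ρ x y) ∧ (∀ x y, ρ x y = 0 ↔ x = y) ∧
    (∃ C₀ : ℝ, 1 ≤ C₀ ∧ ∀ x y, ρ y x ≤ C₀ * ρ x y) ∧
    (∃ C₁ : ℝ, 1 ≤ C₁ ∧ ∀ x y z, ρ x y ≤ C₁ * max (ρ x z) (ρ z y))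

/-- The least admissible quasi-triangle constant `C_ρ`. -/
def Crho (ρ : X → X → ℝ) : ℝ :=
  sInf {C : ℝ | 1 ≤ C ∧ ∀ x y z : X, ρ x y ≤ C * max (ρ x z) (ρ z y)}

/-- The least admissible quasi-symmetry constant `C̃_ρ`. -/
def CrhoTilde (ρ : X → X → ℝ) : ℝ :=
  sInf {C : ℝ | 1 ≤ C ∧ ∀ x y : X, ρ y x ≤ C * ρ x y}

/-- Two quasi-metrics are (bi-Lipschitz, i.e. pointwise) equivalent. -/
def EquivQM (ρ ϱ : X → X → ℝ) : Prop :=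
  ∃ c : ℝ, 1 ≤ c ∧ ∀ x y, c⁻¹ * ϱ x y ≤ ρ x y ∧ ρ x y ≤ c * ϱ x y

variable [MeasurableSpace X]

/-- `(X, ρ, μ)` is a quasi-metric measure space. -/
structure IsQMMS (ρ : X → X → ℝ) (μ : Measure X) : Prop where
  nontrivial : ∃ x y : X, x ≠ y
  quasi : IsQuasiDist ρ
  measurableSet_ball : ∀ (x : X) (r : ℝ), 0 < r → MeasurableSet (qball ρ x r)
  ball_pos : ∀ (x : X) (r : ℝ), 0 < r → 0 < μ (qball ρ x r)
  ball_lt_top : ∀ (x : X) (r : ℝ), 0 < r → μ (qball ρ x r) < ∞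

/-- Every `μ`-measurable set is contained in a Borel (measurable) set of equal measure. -/
def BorelRegular (μ : Measure X) : Prop :=
  ∀ A : Set X, ∃ B : Set X, A ⊆ B ∧ MeasurableSet B ∧ μ A = μ B

/-- `μ` is `Q`-doubling. -/
def QDoubling (ρ : X → X → ℝ) (μ : Measure X) (Q : ℝ) : Prop :=
  ∃ κ : ℝ, 0 < κ ∧ ∀ (x y : X) (r R : ℝ), 0 < r → r ≤ R →
    qball ρ x r ⊆ qball ρ y R →
    ENNReal.ofReal (κ * (r / R) ^ Q) * μ (qball ρ y R) ≤ μ (qball ρ x r)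

/-- `μ` is doubling. -/
def DoublingMeas (ρ : X → X → ℝ) (μ : Measure X) : Prop :=
  ∃ Cd : ℝ, 0 < Cd ∧ ∀ (x : X) (r : ℝ), 0 < r →
    μ (qball ρ x (2 * r)) ≤ ENNReal.ofReal Cd * μ (qball ρ x r)

/-- The measure density condition for `Ω`. -/
def MeasDensity (ρ : X → X → ℝ) (μ : Measure X) (Ω : Set X) : Prop :=
  ∃ c : ℝ, 0 < c ∧ ∀ x ∈ Ω, ∀ r : ℝ, 0 < r → r ≤ 1 →
    μ (qball ρ x r) ≤ ENNReal.ofReal c * μ (qball ρ x r ∩ Ω)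

/-- `Ω` is locally uniformly perfect with constant `lam ∈ (0,1)`. -/
def LocUnifPerfect (ρ : X → X → ℝ) (Ω : Set X) (lam : ℝ) : Prop :=
  ∀ x ∈ Ω, ∀ r : ℝ, 0 < r → r ≤ 1 → (Ω \ qball ρ x r).Nonempty →
    ((qball ρ x r ∩ Ω) \ qball ρ x (lam * r)).Nonempty

/-- The critical radius `φ^x_{Ω,ρ}(r)`. -/
def phiRad (ρ : X → X → ℝ) (μ : Measure X) (Ω : Set X) (x : X) (r : ℝ) : ℝ :=
  sSup {t : ℝ | 0 ≤ t ∧ t ≤ r ∧ μ (qball ρ x t ∩ Ω) ≤ μ (qball ρ x r ∩ Ω) / 2}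

/-- The collection `𝔻^s_ρ(u)` of fractional `s`-gradients of `u` on `Ω`. -/
def fracGrad (ρ : X → X → ℝ) (μ : Measure X) (Ω : Set X) (s : ℝ) (u : X → ℝ) :
    Set (ℤ → X → ℝ) :=
  {g | (∀ k x, 0 ≤ g k x) ∧ (∀ k, AEMeasurable (g k) (μ.restrict Ω)) ∧
    ∃ E : Set X, μ E = 0 ∧ ∀ k : ℤ, ∀ x ∈ Ω \ E, ∀ y ∈ Ω \ E,
      (2 : ℝ) ^ (-k - 1) ≤ ρ x y → ρ x y < (2 : ℝ) ^ (-k) →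
      |u x - u y| ≤ ρ x y ^ s * (g k x + g k y)}

/-- `g` is an `s`-gradient of `u` on `S`. -/
def IsSGradOn (ρ : X → X → ℝ) (μ : Measure X) (S : Set X) (s : ℝ) (u g : X → ℝ) : Prop :=
  (∀ x, 0 ≤ g x) ∧ AEMeasurable g (μ.restrict S) ∧
    ∃ E : Set X, μ E = 0 ∧ ∀ x ∈ S \ E, ∀ y ∈ S \ E,
      |u x - u y| ≤ ρ x y ^ s * (g x + g y)

/-- The `ℓ^q` norm (`0 < q ≤ ∞`) of a `ℤ`-indexed sequence in `[0,∞]`. -/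
def lqN (q : ℝ≥0∞) (a : ℤ → ℝ≥0∞) : ℝ≥0∞ :=
  if q = ∞ then ⨆ k, a k else (∑' k, a k ^ q.toReal) ^ (1 / q.toReal)

/-- The `L^p` "norm" (`0 < p < ∞`) of a `[0,∞]`-valued function. -/
def lpN (μ : Measure X) (p : ℝ) (f : X → ℝ≥0∞) : ℝ≥0∞ :=
  (∫⁻ x, f x ^ p ∂μ) ^ (1 / p)

/-- The `L^p` norm of `u : X → ℝ` over the set `Ω`. -/
def lpOn (μ : Measure X) (Ω : Set X) (p : ℝ) (u : X → ℝ) : ℝ≥0∞ :=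
  lpN (μ.restrict Ω) p fun x => ENNReal.ofReal |u x|

/-- The homogeneous Hajłasz–Triebel–Lizorkin quasi-norm `‖u‖_{Ṁ^s_{p,q}(Ω,ρ,μ)}`. -/
def MdotNorm (ρ : X → X → ℝ) (μ : Measure X) (Ω : Set X) (s p : ℝ) (q : ℝ≥0∞)
    (u : X → ℝ) : ℝ≥0∞ :=
  ⨅ g ∈ fracGrad ρ μ Ω s u,
    lpN (μ.restrict Ω) p fun x => lqN q fun k => ENNReal.ofReal (g k x)

/-- The homogeneous Hajłasz–Besov quasi-norm `‖u‖_{Ṅ^s_{p,q}(Ω,ρ,μ)}`. -/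
def NdotNorm (ρ : X → X → ℝ) (μ : Measure X) (Ω : Set X) (s p : ℝ) (q : ℝ≥0∞)
    (u : X → ℝ) : ℝ≥0∞ :=
  ⨅ g ∈ fracGrad ρ μ Ω s u,
    lqN q fun k => lpN (μ.restrict Ω) p fun x => ENNReal.ofReal (g k x)

/-- Membership in `M^s_{p,q}(Ω,ρ,μ)`. -/
def MemMspq (ρ : X → X → ℝ) (μ : Measure X) (Ω : Set X) (s p : ℝ) (q : ℝ≥0∞)
    (u : X → ℝ) : Prop :=
  AEMeasurable u (μ.restrict Ω) ∧ lpOn μ Ω p u ≠ ∞ ∧ MdotNorm ρ μ Ω s p q u ≠ ∞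

/-- Membership in `N^s_{p,q}(Ω,ρ,μ)`. -/
def MemNspq (ρ : X → X → ℝ) (μ : Measure X) (Ω : Set X) (s p : ℝ) (q : ℝ≥0∞)
    (u : X → ℝ) : Prop :=
  AEMeasurable u (μ.restrict Ω) ∧ lpOn μ Ω p u ≠ ∞ ∧ NdotNorm ρ μ Ω s p q u ≠ ∞

/-- The quasi-norm of `M^s_{p,q}(Ω,ρ,μ)`. -/
def MNorm (ρ : X → X → ℝ) (μ : Measure X) (Ω : Set X) (s p : ℝ) (q : ℝ≥0∞)
    (u : X → ℝ) : ℝ≥0∞ :=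
  MdotNorm ρ μ Ω s p q u + lpOn μ Ω p u

/-- The quasi-norm of `N^s_{p,q}(Ω,ρ,μ)`. -/
def NNorm (ρ : X → X → ℝ) (μ : Measure X) (Ω : Set X) (s p : ℝ) (q : ℝ≥0∞)
    (u : X → ℝ) : ℝ≥0∞ :=
  NdotNorm ρ μ Ω s p q u + lpOn μ Ω p u

/-- `s ⪯_q ind(X,ρ)` : there is a quasi-metric `ϱ ≈ ρ` with `s ≤ (log₂ C_ϱ)⁻¹`
(equivalently `C_ϱ ^ s ≤ 2`), where equality is permitted only when `q = ∞`. -/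
def SPrecIndex (ρ : X → X → ℝ) (s : ℝ) (q : ℝ≥0∞) : Prop :=
  ∃ ϱ : X → X → ℝ, IsQuasiDist ϱ ∧ EquivQM ρ ϱ ∧
    (Crho ϱ ^ s < 2 ∨ (q = ∞ ∧ Crho ϱ ^ s ≤ 2))

/-- `s < ind(X,ρ)` : there is a quasi-metric `ϱ ≈ ρ` with `s < (log₂ C_ϱ)⁻¹`
(equivalently `C_ϱ ^ s < 2`). -/
def SLtIndex (ρ : X → X → ℝ) (s : ℝ) : Prop :=
  ∃ ϱ : X → X → ℝ, IsQuasiDist ϱ ∧ EquivQM ρ ϱ ∧ Crho ϱ ^ s < 2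

/-- The median value `m_u(E)`. -/
def medianVal (μ : Measure X) (E : Set X) (u : X → ℝ) : ℝ :=
  sSup {θ : ℝ | μ {x ∈ E | u x < θ} ≤ μ E / 2}

/-- `f` belongs to the homogeneous Hölder space `Ċ^α(X,ρ)`. -/
def MemHolder (ρ : X → X → ℝ) (α : ℝ) (f : X → ℝ) : Prop :=
  ∃ H : ℝ, 0 ≤ H ∧ ∀ x y : X, |f x - f y| ≤ H * ρ x y ^ α

/-- The Hölder seminorm `‖f‖_{Ċ^α(X,ρ)}`. -/
def holderNorm (ρ : X → X → ℝ) (α : ℝ) (f : X → ℝ) : ℝ :=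
  sInf {H : ℝ | 0 ≤ H ∧ ∀ x y : X, |f x - f y| ≤ H * ρ x y ^ α}

/-- The sup norm of `f`. -/
def supNorm (f : X → ℝ) : ℝ := sSup (Set.range fun x => |f x|)

/-- `ρ` is a genuine metric. -/
def IsMetricDist (ρ : X → X → ℝ) : Prop :=
  (∀ x y, 0 ≤ ρ x y) ∧ (∀ x y, ρ x y = 0 ↔ x = y) ∧ (∀ x y, ρ x y = ρ y x) ∧
    (∀ x y z, ρ x y ≤ ρ x z + ρ z y)

/-- The homogeneous Hajłasz–Sobolev quasi-norm `‖u‖_{Ṁ^{1,p}(Ω,ρ,μ)}`. -/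
def M1pDotNorm (ρ : X → X → ℝ) (μ : Measure X) (Ω : Set X) (p : ℝ) (u : X → ℝ) : ℝ≥0∞ :=
  ⨅ g ∈ {g : X → ℝ | IsSGradOn ρ μ Ω 1 u g},
    lpN (μ.restrict Ω) p fun x => ENNReal.ofReal (g x)

/-- Membership in the Hajłasz–Sobolev space `M^{1,p}(Ω,ρ,μ)`. -/
def MemM1p (ρ : X → X → ℝ) (μ : Measure X) (Ω : Set X) (p : ℝ) (u : X → ℝ) : Prop :=
  AEMeasurable u (μ.restrict Ω) ∧ lpOn μ Ω p u ≠ ∞ ∧ M1pDotNorm ρ μ Ω p u ≠ ∞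

/-- The quasi-norm of `M^{1,p}(Ω,ρ,μ)`. -/
def M1pNorm (ρ : X → X → ℝ) (μ : Measure X) (Ω : Set X) (p : ℝ) (u : X → ℝ) : ℝ≥0∞ :=
  lpOn μ Ω p u + M1pDotNorm ρ μ Ω p u


/-- A power of a finite sum is bounded by a multiple of the sum of the powers, for any
exponent `r > 0`. -/
theorem sum_rpow_le_card_rpow_mul {ι : Type*} (S : Finset ι) (b : ι → ℝ≥0∞) {r : ℝ}
    (hr : 0 < r) : (∑ j ∈ S, b j) ^ r ≤ (S.card : ℝ≥0∞) ^ r * ∑ j ∈ S, b j ^ r := by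
  rcases S.eq_empty_or_nonempty with rfl | hS
  · simp [hr]
  obtain ⟨i, hi, hmax⟩ := S.exists_max_image b hS
  calc (∑ j ∈ S, b j) ^ r ≤ (S.card * b i) ^ r := by
        gcongr
        simpa using S.sum_le_card_nsmul b (b i) hmax
    _ = (S.card : ℝ≥0∞) ^ r * b i ^ r := ENNReal.mul_rpow_of_nonneg _ _ hr.le
    _ ≤ _ := by
        gcongr
        exact Finset.single_le_sum (f := fun j => b j ^ r) (fun _ _ => zero_le) hi

theorem lqN_mono {q : ℝ≥0∞} {a b : ℤ → ℝ≥0∞} (h : ∀ k, a k ≤ b k) : lqN q a ≤ lqN q b := by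
  unfold lqN
  split_ifs
  · exact iSup_mono h
  · gcongr with k
    exact h k

theorem lqN_const_mul {q : ℝ≥0∞} (hq : 0 < q) (C : ℝ≥0∞) (a : ℤ → ℝ≥0∞) :
    lqN q (fun k => C * a k) = C * lqN q a := by
  unfold lqN
  split_ifs with h
  · exact (ENNReal.mul_iSup _ _).symm
  · have hr : 0 < q.toReal := ENNReal.toReal_pos hq.ne' h
    simp_rw [ENNReal.mul_rpow_of_nonneg _ _ hr.le]
    rw [ENNReal.tsum_mul_left, ENNReal.mul_rpow_of_nonneg _ _ (by positivity),
      ← ENNReal.rpow_mul, mul_one_div_cancel hr.ne', ENNReal.rpow_one]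

/-- Summing finitely many shifts is bounded on `ℓ^q` for every `0 < q ≤ ∞`. -/
theorem lqN_sum_shift_le {q : ℝ≥0∞} (hq : 0 < q) (S : Finset ℤ) (a : ℤ → ℝ≥0∞) :
    lqN q (fun k => ∑ j ∈ S, a (k + j)) ≤
      S.card * (S.card : ℝ≥0∞) ^ (1 / q.toReal) * lqN q a := by
  unfold lqN
  split_ifs with h
  · refine iSup_le fun k => ?_
    simpa [h] using S.sum_le_card_nsmul _ _ fun j _ => le_iSup a (k + j)
  · have hr : 0 < q.toReal := ENNReal.toReal_pos hq.ne' h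
    set r := q.toReal
    have shift (j : ℤ) : ∑' k, a (k + j) ^ r = ∑' k, a k ^ r :=
      (Equiv.addRight j).tsum_eq fun k => a k ^ r
    calc (∑' k, (∑ j ∈ S, a (k + j)) ^ r) ^ (1 / r)
        ≤ (∑' k, (S.card : ℝ≥0∞) ^ r * ∑ j ∈ S, a (k + j) ^ r) ^ (1 / r) := by
          gcongr with k
          exact sum_rpow_le_card_rpow_mul S _ hr
      _ = ((S.card : ℝ≥0∞) ^ r * (S.card * ∑' k, a k ^ r)) ^ (1 / r) := by
          rw [ENNReal.tsum_mul_left, Summable.tsum_finsetSum fun _ _ => ENNReal.summable]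
          simp [shift]
      _ = _ := by
          rw [ENNReal.mul_rpow_of_nonneg _ _ (by positivity),
            ENNReal.mul_rpow_of_nonneg _ _ (by positivity), ← ENNReal.rpow_mul,
            mul_one_div_cancel hr.ne', ENNReal.rpow_one, mul_assoc]

theorem lpN_mono {μ : Measure X} {p : ℝ} (hp : 0 < p) {f g : X → ℝ≥0∞} (h : ∀ x, f x ≤ g x) :
    lpN μ p f ≤ lpN μ p g := by
  unfold lpN
  gcongr with x
  exact h x

theorem lpN_const_mul {μ : Measure X} {p : ℝ} (hp : 0 < p) {C : ℝ≥0∞} (hC : C ≠ ∞)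
    (f : X → ℝ≥0∞) : lpN μ p (fun x => C * f x) = C * lpN μ p f := by
  unfold lpN
  simp_rw [ENNReal.mul_rpow_of_nonneg _ _ hp.le]
  rw [lintegral_const_mul' _ _ (ENNReal.rpow_ne_top_of_nonneg hp.le hC),
    ENNReal.mul_rpow_of_nonneg _ _ (by positivity), ← ENNReal.rpow_mul,
    mul_one_div_cancel hp.ne', ENNReal.rpow_one]

/-- The quasi-triangle inequality in `L^p` for finite sums, for every `0 < p < ∞`. -/
theorem lpN_sum_le {ι : Type*} {μ : Measure X} {p : ℝ} (hp : 0 < p) (S : Finset ι)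
    {f : ι → X → ℝ≥0∞} (hf : ∀ j, AEMeasurable (f j) μ) :
    lpN μ p (fun x => ∑ j ∈ S, f j x) ≤
      S.card * (S.card : ℝ≥0∞) ^ (1 / p) * ∑ j ∈ S, lpN μ p (f j) := by
  have int_eq (j : ι) : ∫⁻ x, f j x ^ p ∂μ = lpN μ p (f j) ^ p := by
    rw [lpN, ← ENNReal.rpow_mul, one_div_mul_cancel hp.ne', ENNReal.rpow_one]
  set L := ∑ j ∈ S, lpN μ p (f j)
  calc lpN μ p (fun x => ∑ j ∈ S, f j x)
      ≤ (∫⁻ x, (S.card : ℝ≥0∞) ^ p * ∑ j ∈ S, f j x ^ p ∂μ) ^ (1 / p) := by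
        unfold lpN
        gcongr with x
        exact sum_rpow_le_card_rpow_mul S _ hp
    _ = ((S.card : ℝ≥0∞) ^ p * ∑ j ∈ S, lpN μ p (f j) ^ p) ^ (1 / p) := by
        rw [lintegral_const_mul' _ _ (ENNReal.rpow_ne_top_of_nonneg hp.le (by simp)),
          lintegral_finsetSum' _ fun j _ => (hf j).pow_const p]
        simp_rw [int_eq]
    _ ≤ ((S.card : ℝ≥0∞) ^ p * (S.card * L ^ p)) ^ (1 / p) := by
        gcongr
        rw [← nsmul_eq_mul]
        refine S.sum_le_card_nsmul _ _ fun j hj => ?_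
        gcongr
        exact Finset.single_le_sum (f := fun j => lpN μ p (f j)) (fun _ _ => zero_le) hj
    _ = _ := by
        rw [ENNReal.mul_rpow_of_nonneg _ _ (by positivity),
          ENNReal.mul_rpow_of_nonneg _ _ (by positivity), ← ENNReal.rpow_mul,
          ← ENNReal.rpow_mul, mul_one_div_cancel hp.ne', ENNReal.rpow_one, ENNReal.rpow_one,
          mul_assoc]

/-- A fractional gradient for `ϱ` yields one for a comparable `ρ`, by summing over the
neighbouring dyadic scales. -/
theorem sum_shift_mem_fracGrad {ρ ϱ : X → X → ℝ} {μ : Measure X} {Ω : Set X} {s c : ℝ}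
    {u : X → ℝ} {N : ℕ} (hs : 0 ≤ s) (hc : 0 < c) (hcN : c ≤ 2 ^ N)
    (h₁ : ∀ x y, ρ x y ≤ c * ϱ x y) (h₂ : ∀ x y, ϱ x y ≤ c * ρ x y)
    {g : ℤ → X → ℝ} (hg : g ∈ fracGrad ϱ μ Ω s u) :
    (fun k x => c ^ s * ∑ j ∈ Finset.Icc (-N : ℤ) N, g (k + j) x) ∈ fracGrad ρ μ Ω s u := by
  obtain ⟨g_nonneg, g_meas, E, hE, hgE⟩ := hg
  refine ⟨fun k x => mul_nonneg (by positivity) (Finset.sum_nonneg fun j _ => g_nonneg _ x),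
    fun k => (Finset.aemeasurable_fun_sum _ fun j _ => g_meas (k + j)).const_mul _, E, hE, ?_⟩
  intro k x hx y hy hlo hhi
  have hρpos : 0 < ρ x y := lt_of_lt_of_le (by positivity) hlo
  have hϱpos : 0 < ϱ x y := pos_of_mul_pos_right (hρpos.trans_le (h₁ x y)) hc.le
  obtain ⟨n, hn₁, hn₂⟩ := exists_mem_Ico_zpow hϱpos (one_lt_two (α := ℝ))
  obtain ⟨m, rfl⟩ : ∃ m : ℤ, n = -m - 1 := ⟨-n - 1, by ring⟩
  rw [sub_add_cancel] at hn₂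
  have hc' : c ≤ (2 : ℝ) ^ (N : ℤ) := by simpa using hcN
  have upper : -m - 1 < N + -k := by
    rw [← zpow_lt_zpow_iff_right₀ (one_lt_two (α := ℝ)), zpow_add₀ two_ne_zero]
    calc (2 : ℝ) ^ (-m - 1) ≤ c * ρ x y := hn₁.trans (h₂ x y)
      _ < c * 2 ^ (-k) := by gcongr
      _ ≤ _ := by gcongr
  have lower : -k - 1 < N + -m := by
    rw [← zpow_lt_zpow_iff_right₀ (one_lt_two (α := ℝ)), zpow_add₀ two_ne_zero]
    calc (2 : ℝ) ^ (-k - 1) ≤ c * ϱ x y := hlo.trans (h₁ x y)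
      _ < c * 2 ^ (-m) := by gcongr
      _ ≤ _ := by gcongr
  have hmem : m - k ∈ Finset.Icc (-N : ℤ) N := by
    rw [Finset.mem_Icc]
    omega
  have g_le (z : X) : g m z ≤ ∑ j ∈ Finset.Icc (-N : ℤ) N, g (k + j) z := by
    simpa using Finset.single_le_sum (f := fun j => g (k + j) z) (fun j _ => g_nonneg _ z) hmem
  calc |u x - u y| ≤ ϱ x y ^ s * (g m x + g m y) := hgE m x hx y hy hn₁ hn₂
    _ ≤ (c * ρ x y) ^ s * (∑ j ∈ Finset.Icc (-N : ℤ) N, g (k + j) x +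
          ∑ j ∈ Finset.Icc (-N : ℤ) N, g (k + j) y) := by
        gcongr
        · exact add_nonneg (g_nonneg m x) (g_nonneg m y)
        · exact h₂ x y
        · exact g_le x
        · exact g_le y
    _ = _ := by
        rw [Real.mul_rpow hc.le hρpos.le]
        ring

theorem ofReal_mul_sum_shift {α : Type*} {g : ℤ → α → ℝ} (hg : ∀ k x, 0 ≤ g k x) {a : ℝ}
    (ha : 0 ≤ a) (S : Finset ℤ) (k : ℤ) (x : α) :
    ENNReal.ofReal (a * ∑ j ∈ S, g (k + j) x) =
      ENNReal.ofReal a * ∑ j ∈ S, ENNReal.ofReal (g (k + j) x) := by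
  rw [ENNReal.ofReal_mul ha, ENNReal.ofReal_sum_of_nonneg fun j _ => hg _ x]

/-- Comparable `ρ` and `ϱ`: one-sided bound of the Triebel–Lizorkin quasi-norms. -/
theorem MdotNorm_le_of_comparable {ρ ϱ : X → X → ℝ} {μ : Measure X} {Ω : Set X} {s p c : ℝ}
    {q : ℝ≥0∞} {N : ℕ} (hs : 0 ≤ s) (hp : 0 < p) (hq : 0 < q) (hc : 0 < c) (hcN : c ≤ 2 ^ N)
    (h₁ : ∀ x y, ρ x y ≤ c * ϱ x y) (h₂ : ∀ x y, ϱ x y ≤ c * ρ x y) (u : X → ℝ) :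
    MdotNorm ρ μ Ω s p q u ≤
      ENNReal.ofReal (c ^ s) * ((Finset.Icc (-N : ℤ) N).card *
        ((Finset.Icc (-N : ℤ) N).card : ℝ≥0∞) ^ (1 / q.toReal)) * MdotNorm ϱ μ Ω s p q u := by
  set S := Finset.Icc (-N : ℤ) N
  set K : ℝ≥0∞ := ENNReal.ofReal (c ^ s) * (S.card * (S.card : ℝ≥0∞) ^ (1 / q.toReal))
  have hK : K ≠ ∞ := ENNReal.mul_ne_top ENNReal.ofReal_ne_top
    (ENNReal.mul_ne_top (by simp) (ENNReal.rpow_ne_top_of_nonneg (by positivity) (by simp)))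
  have hcard : (S.card : ℝ≥0∞) ≠ 0 := by simp [S]; omega
  have hK₀ : K ≠ 0 := mul_ne_zero (by simp; positivity)
    (mul_ne_zero hcard (ENNReal.rpow_pos hcard.bot_lt (by simp)).ne')
  simp_rw [MdotNorm, ENNReal.mul_iInf_of_ne hK₀ hK]
  refine le_iInf₂ fun g hg => (iInf₂_le _ (sum_shift_mem_fracGrad hs hc hcN h₁ h₂ hg)).trans ?_
  rw [← lpN_const_mul hp hK]
  refine lpN_mono hp fun x => ?_
  simp_rw [ofReal_mul_sum_shift hg.1 (Real.rpow_nonneg hc.le s), K, mul_assoc]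
  rw [lqN_const_mul hq, ← mul_assoc (S.card : ℝ≥0∞)]
  gcongr
  exact lqN_sum_shift_le hq S fun k => ENNReal.ofReal (g k x)

/-- Comparable `ρ` and `ϱ`: one-sided bound of the Besov quasi-norms. -/
theorem NdotNorm_le_of_comparable {ρ ϱ : X → X → ℝ} {μ : Measure X} {Ω : Set X} {s p c : ℝ}
    {q : ℝ≥0∞} {N : ℕ} (hs : 0 ≤ s) (hp : 0 < p) (hq : 0 < q) (hc : 0 < c) (hcN : c ≤ 2 ^ N)
    (h₁ : ∀ x y, ρ x y ≤ c * ϱ x y) (h₂ : ∀ x y, ϱ x y ≤ c * ρ x y) (u : X → ℝ) :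
    NdotNorm ρ μ Ω s p q u ≤
      ENNReal.ofReal (c ^ s) * ((Finset.Icc (-N : ℤ) N).card *
        ((Finset.Icc (-N : ℤ) N).card : ℝ≥0∞) ^ (1 / p)) * ((Finset.Icc (-N : ℤ) N).card *
        ((Finset.Icc (-N : ℤ) N).card : ℝ≥0∞) ^ (1 / q.toReal)) * NdotNorm ϱ μ Ω s p q u := by
  set S := Finset.Icc (-N : ℤ) N
  set A : ℝ≥0∞ := ENNReal.ofReal (c ^ s) * (S.card * (S.card : ℝ≥0∞) ^ (1 / p))
  set B : ℝ≥0∞ := S.card * (S.card : ℝ≥0∞) ^ (1 / q.toReal)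
  have hA : A ≠ ∞ := ENNReal.mul_ne_top ENNReal.ofReal_ne_top
    (ENNReal.mul_ne_top (by simp) (ENNReal.rpow_ne_top_of_nonneg (by positivity) (by simp)))
  have hB : B ≠ ∞ :=
    ENNReal.mul_ne_top (by simp) (ENNReal.rpow_ne_top_of_nonneg (by positivity) (by simp))
  have hcard : (S.card : ℝ≥0∞) ≠ 0 := by simp [S]; omega
  have hA₀ : A ≠ 0 := mul_ne_zero (by simp; positivity)
    (mul_ne_zero hcard (ENNReal.rpow_pos hcard.bot_lt (by simp)).ne')
  have hB₀ : B ≠ 0 := mul_ne_zero hcard (ENNReal.rpow_pos hcard.bot_lt (by simp)).ne'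
  simp_rw [NdotNorm, ENNReal.mul_iInf_of_ne (mul_ne_zero hA₀ hB₀) (ENNReal.mul_ne_top hA hB)]
  refine le_iInf₂ fun g hg => (iInf₂_le _ (sum_shift_mem_fracGrad hs hc hcN h₁ h₂ hg)).trans ?_
  simp_rw [ofReal_mul_sum_shift hg.1 (Real.rpow_nonneg hc.le s),
    lpN_const_mul hp ENNReal.ofReal_ne_top]
  set a : ℤ → ℝ≥0∞ := fun k => lpN (μ.restrict Ω) p fun x => ENNReal.ofReal (g k x)
  calc _ ≤ lqN q fun k => A * ∑ j ∈ S, a (k + j) := by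
        refine lqN_mono fun k => ?_
        rw [mul_assoc]
        gcongr
        exact lpN_sum_le hp S fun j => (hg.2.1 (k + j)).ennreal_ofReal
    _ ≤ A * (B * lqN q a) := by
        rw [lqN_const_mul hq]
        gcongr
        exact lqN_sum_shift_le hq S a
    _ = _ := (mul_assoc _ _ _).symm

/-- Proposition 2.1: equivalent quasi-metrics generate the same Hajłasz–Triebel–Lizorkin
and Hajłasz–Besov spaces, with equivalent (quasi-)norms. -/
theorem equiv_quasiMetrics_same_spaces
    {X : Type*} [MeasurableSpace X] (ρ ϱ : X → X → ℝ) (μ : Measure X)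
    (hρ : IsQuasiDist ρ) (hϱ : IsQuasiDist ϱ)
    (hρball : ∀ (x : X) (r : ℝ), 0 < r → MeasurableSet (qball ρ x r))
    (hϱball : ∀ (x : X) (r : ℝ), 0 < r → MeasurableSet (qball ϱ x r))
    (hequiv : EquivQM ρ ϱ)
    (s p : ℝ) (q : ℝ≥0∞) (hs : 0 < s) (hp : 0 < p) (hq : 0 < q) :
    ∃ C : ℝ, 0 < C ∧ ∀ u : X → ℝ,
      (MdotNorm ρ μ Set.univ s p q u ≤ ENNReal.ofReal C * MdotNorm ϱ μ Set.univ s p q u ∧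
        MdotNorm ϱ μ Set.univ s p q u ≤ ENNReal.ofReal C * MdotNorm ρ μ Set.univ s p q u) ∧
      (NdotNorm ρ μ Set.univ s p q u ≤ ENNReal.ofReal C * NdotNorm ϱ μ Set.univ s p q u ∧
        NdotNorm ϱ μ Set.univ s p q u ≤ ENNReal.ofReal C * NdotNorm ρ μ Set.univ s p q u) ∧
      (MNorm ρ μ Set.univ s p q u ≤ ENNReal.ofReal C * MNorm ϱ μ Set.univ s p q u ∧
        MNorm ϱ μ Set.univ s p q u ≤ ENNReal.ofReal C * MNorm ρ μ Set.univ s p q u) ∧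
      (NNorm ρ μ Set.univ s p q u ≤ ENNReal.ofReal C * NNorm ϱ μ Set.univ s p q u ∧
        NNorm ϱ μ Set.univ s p q u ≤ ENNReal.ofReal C * NNorm ρ μ Set.univ s p q u) := by
  obtain ⟨c, hc, hequiv⟩ := hequiv
  have hc₀ : 0 < c := one_pos.trans_le hc
  have h₁ x y : ρ x y ≤ c * ϱ x y := (hequiv x y).2
  have h₂ x y : ϱ x y ≤ c * ρ x y := (inv_mul_le_iff₀ hc₀).1 (hequiv x y).1
  obtain ⟨N, hN⟩ := pow_unbounded_of_one_lt c (one_lt_two (α := ℝ))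
  set n : ℝ≥0∞ := ((Finset.Icc (-N : ℤ) N).card : ℝ≥0∞)
  set K₁ : ℝ≥0∞ := ENNReal.ofReal (c ^ s) * (n * n ^ (1 / q.toReal))
  set K₂ : ℝ≥0∞ := ENNReal.ofReal (c ^ s) * (n * n ^ (1 / p)) * (n * n ^ (1 / q.toReal))
  have n_top : n ≠ ∞ := ENNReal.natCast_ne_top _
  have pow_top {r : ℝ} (hr : 0 ≤ r) : n * n ^ r ≠ ∞ :=
    ENNReal.mul_ne_top n_top (ENNReal.rpow_ne_top_of_nonneg hr n_top)
  have hK₁_top : K₁ ≠ ∞ := ENNReal.mul_ne_top ENNReal.ofReal_ne_top (pow_top (by positivity))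
  have hK₂_top : K₂ ≠ ∞ := ENNReal.mul_ne_top
    (ENNReal.mul_ne_top ENNReal.ofReal_ne_top (pow_top (by positivity))) (pow_top (by positivity))
  have hF {ρ ϱ : X → X → ℝ} (h₁ : ∀ x y, ρ x y ≤ c * ϱ x y) (h₂ : ∀ x y, ϱ x y ≤ c * ρ x y)
      (u : X → ℝ) : MdotNorm ρ μ univ s p q u ≤ (1 + K₁ + K₂) * MdotNorm ϱ μ univ s p q u :=
    (MdotNorm_le_of_comparable hs.le hp hq hc₀ hN.le h₁ h₂ u).trans <| by
      gcongr
      exact le_add_right le_add_self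
  have hB {ρ ϱ : X → X → ℝ} (h₁ : ∀ x y, ρ x y ≤ c * ϱ x y) (h₂ : ∀ x y, ϱ x y ≤ c * ρ x y)
      (u : X → ℝ) : NdotNorm ρ μ univ s p q u ≤ (1 + K₁ + K₂) * NdotNorm ϱ μ univ s p q u :=
    (NdotNorm_le_of_comparable hs.le hp hq hc₀ hN.le h₁ h₂ u).trans <| by
      gcongr
      exact le_add_self
  have add_lp {a b : ℝ≥0∞} (l : ℝ≥0∞) (h : a ≤ (1 + K₁ + K₂) * b) :
      a + l ≤ (1 + K₁ + K₂) * (b + l) := by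
    rw [mul_add]
    refine add_le_add h (le_mul_of_one_le_left zero_le ?_)
    rw [add_assoc]
    exact le_self_add
  have hC_top : 1 + K₁ + K₂ ≠ ∞ := by simp [hK₁_top, hK₂_top]
  refine ⟨(1 + K₁ + K₂).toReal, ENNReal.toReal_pos (by simp) hC_top, fun u => ?_⟩
  rw [ENNReal.ofReal_toReal hC_top]
  exact ⟨⟨hF h₁ h₂ u, hF h₂ h₁ u⟩, ⟨hB h₁ h₂ u, hB h₂ h₁ u⟩,
    ⟨add_lp _ (hF h₁ h₂ u), add_lp _ (hF h₂ h₁ u)⟩, ⟨add_lp _ (hB h₁ h₂ u), add_lp _ (hB h₂ h₁ u)⟩⟩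

end HajlaszPaper
end
end

section
/- Let (X,ρ,μ) be a quasi-metric measure space in which μ is Q-doubling for some Q ∈ (0,∞), and let Ω ⊂ X be a nonempty μ-measurable set satisfying the measure density condition. Fix t,s,ε,ε' ∈ (0,∞) with t < Q/ε' and ε' < ε < s, and let k₀ ∈ ℕ satisfy 2^{k₀} ≥ C_ρ² C̃_ρ. Then for every r* ∈ [1,∞) there is a constant C > 0 (depending on r*, μ, ρ, Q, t, ε', ε) such that for every μ-measurable u: Ω→ℝ, every fractional s-gradient (g_k)_{k∈ℤ} ∈ 𝔻^s_ρ(u) (extended by g_k ≡ 0 on X∖Ω), every x ∈ Ω and every L ∈ ℤ with 2^{−L} ≤ r*: inf_{γ∈ℝ} ( ⨍_{B_ρ(x,2^{−L})∩Ω} |u−γ|^{t*} dμ )^{1/t*} ≤ C 2^{−Lε} ( ⨍_{B_ρ(x,C_ρ 2^{−L})} sup_{j ≥ L−k₀} { 2^{−j(s−ε)t} g_j^t } dμ )^{1/t}, where t* := Qt/(Q−ε't) and ⨍_E denotes the μ-average over E. -/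
open MeasureTheory ENNReal Set

noncomputable section

namespace HajlaszPaper

variable {X : Type*}

variable [MeasurableSpace X]

theorem crho_spec {X : Type*} {ρ : X → X → ℝ} (hq : IsQuasiDist ρ) :
    1 ≤ Crho ρ ∧ ∀ x y z, ρ x y ≤ Crho ρ * max (ρ x z) (ρ z y) := by
  obtain ⟨-, -, -, C₁, h1, h2⟩ := hq
  have hcl : IsClosed {C : ℝ | 1 ≤ C ∧ ∀ x y z : X, ρ x y ≤ C * max (ρ x z) (ρ z y)} := by
    simp only [ofPred_and, ofPred_forall]
    refine isClosed_Ici.inter ?_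
    refine isClosed_iInter fun x => isClosed_iInter fun y => isClosed_iInter fun z => ?_
    exact isClosed_le continuous_const (continuous_id.mul continuous_const)
  exact hcl.csInf_mem ⟨C₁, h1, h2⟩ ⟨1, fun C hC => hC.1⟩

theorem crhoTilde_spec {X : Type*} {ρ : X → X → ℝ} (hq : IsQuasiDist ρ) :
    1 ≤ CrhoTilde ρ ∧ ∀ x y, ρ y x ≤ CrhoTilde ρ * ρ x y := by
  obtain ⟨-, -, ⟨C₀, h1, h2⟩, -⟩ := hq
  have hcl : IsClosed {C : ℝ | 1 ≤ C ∧ ∀ x y : X, ρ y x ≤ C * ρ x y} := by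
    simp only [ofPred_and, ofPred_forall]
    refine isClosed_Ici.inter ?_
    refine isClosed_iInter fun x => isClosed_iInter fun y => ?_
    exact isClosed_le continuous_const (continuous_id.mul continuous_const)
  exact hcl.csInf_mem ⟨C₀, h1, h2⟩ ⟨1, fun C hC => hC.1⟩

theorem abs_sub_le_of_geometric_steps {v : ℕ → ℝ} {K b : ℝ} (hK : 0 ≤ K) (hb : 1 < b)
    (h : ∀ i, |v (i + 1) - v i| ≤ K * b ^ i) (n : ℕ) :
    |v n - v 0| ≤ K * b ^ n / (b - 1) := by
  have hb' : 0 < b - 1 := by linarith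
  induction n with
  | zero => simp only [sub_self, abs_zero]; positivity
  | succ n ih =>
    calc |v (n + 1) - v 0| ≤ |v (n + 1) - v n| + |v n - v 0| := abs_sub_le _ _ _
      _ ≤ K * b ^ n + K * b ^ n / (b - 1) := add_le_add (h n) ih
      _ = K * b ^ (n + 1) / (b - 1) := by field_simp; ring

/-- Chaining: if `H` controls the oscillation of `u` and every point of `S` has points of `D`
close to it at which `H` is small, then `u` is close to a constant on the sublevels of `H`. -/
theorem exists_const_abs_sub_le_of_near {X : Type*} {ρ : X → X → ℝ} {S D : Set X} {u : X → ℝ}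
    {H : X → ℝ≥0∞} {t α r lam A G w : ℝ} (hα : 0 < α) (hr : 0 < r) (hlam : 0 < lam)
    (hA : 1 ≤ A) (hG : 0 < G) (hw : 0 < w) (hw1 : w < 1) (hb : 1 < 2 * w ^ α) (ht : 0 < t)
    (hS : S.Nonempty) (hSD : S ⊆ D) (hρ : ∀ x y, 0 ≤ ρ x y)
    (htri : ∀ y z z', ρ z z' ≤ A * max (ρ y z) (ρ y z'))
    (hdiam : ∀ y ∈ D, ∀ z ∈ D, ρ y z ≤ A * r)
    (hgrad : ∀ y ∈ D, ∀ z ∈ D, ∀ a : ℝ, 0 ≤ a → H y ≤ ENNReal.ofReal (a ^ t) →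
      H z ≤ ENNReal.ofReal (a ^ t) → |u y - u z| ≤ G * a * ρ y z ^ α)
    (hnear : ∀ y ∈ S, ∀ i : ℕ, ∃ z ∈ D, ρ y z < r * w ^ i ∧
      H z ≤ ENNReal.ofReal ((2 ^ i * lam) ^ t)) :
    ∃ γ : ℝ, ∀ y ∈ S, ∀ n : ℕ, H y ≤ ENNReal.ofReal ((2 ^ n * lam) ^ t) →
      |u y - γ| ≤ 2 * G * lam * (A * r) ^ α * (1 / (2 * w ^ α - 1) + 2) * (2 * w ^ α) ^ n := by
  obtain ⟨x, hx⟩ := hS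
  obtain ⟨z', hz'D, -, hz'H⟩ := hnear x hx 0
  refine ⟨u z', fun y hy n hn => ?_⟩
  choose z hzD hzρ hzH using hnear y hy
  set b := 2 * w ^ α with hbdef
  set K := 2 * G * lam * (A * r) ^ α with hKdef
  have hA0 : 0 < A := by linarith
  have hK : 0 < K := by positivity
  have hmono : ∀ i : ℕ, H (z i) ≤ ENNReal.ofReal ((2 ^ (i + 1) * lam) ^ t) := fun i =>
    (hzH i).trans (ENNReal.ofReal_le_ofReal (by gcongr <;> norm_num))
  have hpow : ∀ i : ℕ, (A * (r * w ^ i)) ^ α = (A * r) ^ α * (w ^ α) ^ i := fun i => by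
    rw [← mul_assoc, Real.mul_rpow (by positivity) (by positivity), ← Real.rpow_natCast,
      ← Real.rpow_natCast, ← Real.rpow_mul hw.le, ← Real.rpow_mul hw.le, mul_comm α]
  have hsteps : ∀ i, |u (z (i + 1)) - u (z i)| ≤ K * b ^ i := fun i => by
    have h1 := hgrad _ (hzD (i + 1)) _ (hzD i) (2 ^ (i + 1) * lam) (by positivity)
      (hzH (i + 1)) (hmono i)
    have h2 : ρ (z (i + 1)) (z i) ≤ A * (r * w ^ i) := by
      refine (htri y _ _).trans ?_
      gcongr
      refine max_le ((hzρ _).le.trans ?_) (hzρ i).le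
      gcongr ?_ * ?_
      exact pow_le_pow_of_le_one hw.le hw1.le (Nat.le_succ i)
    calc _ ≤ G * (2 ^ (i + 1) * lam) * (A * (r * w ^ i)) ^ α := by
          refine h1.trans ?_
          gcongr
          exact hρ _ _
      _ = K * b ^ i := by rw [hpow, hKdef, hbdef, mul_pow]; ring
  have hchain := abs_sub_le_of_geometric_steps (v := fun i => u (z i)) hK.le hb hsteps n
  have hlast : |u y - u (z n)| ≤ K * b ^ n := by
    have h1 := hgrad _ (hSD hy) _ (hzD n) (2 ^ n * lam) (by positivity) hn (hzH n)
    calc _ ≤ G * (2 ^ n * lam) * (A * (r * w ^ n)) ^ α := by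
          refine h1.trans ?_
          gcongr
          · exact hρ _ _
          · exact (hzρ n).le.trans (le_mul_of_one_le_left (by positivity) hA)
      _ = K * b ^ n / 2 := by rw [hpow, hKdef, hbdef, mul_pow]; ring
      _ ≤ K * b ^ n := half_le_self (by positivity)
  have hfirst : |u (z 0) - u z'| ≤ K * b ^ n := by
    have h1 := hgrad _ (hzD 0) _ hz'D (2 ^ 0 * lam) (by positivity) (hzH 0) hz'H
    calc _ ≤ G * (2 ^ 0 * lam) * (A * r) ^ α := by
          refine h1.trans ?_
          gcongr
          · exact hρ _ _
          · exact hdiam _ (hzD 0) _ hz'D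
      _ = K / 2 := by rw [hKdef]; ring
      _ ≤ K := half_le_self hK.le
      _ ≤ K * b ^ n := le_mul_of_one_le_right hK.le (one_le_pow₀ hb.le)
  calc |u y - u z'| ≤ |u y - u (z n)| + (|u (z n) - u (z 0)| + |u (z 0) - u z'|) :=
        (abs_sub_le _ _ _).trans (add_le_add_right (abs_sub_le _ _ _) _)
    _ ≤ K * b ^ n + (K * b ^ n / (b - 1) + K * b ^ n) := by gcongr
    _ = K * (1 / (b - 1) + 2) * b ^ n := by ring

theorem ofReal_rpow_le_of_geometric {a P lam b t p : ℝ} {h : ℝ≥0∞} (ha : 0 ≤ a) (hP : 0 < P)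
    (hlam : 0 < lam) (ht : 0 < t) (hp : 0 < p) (hb : 0 < b) (hbp : b ^ p = 2 ^ t)
    (H : ∀ n : ℕ, h ≤ ENNReal.ofReal ((2 ^ n * lam) ^ t) → a ≤ P * b ^ n) :
    ENNReal.ofReal a ^ p ≤
      ENNReal.ofReal (P ^ p) * (1 + ENNReal.ofReal (2 ^ t / lam ^ t) * h) := by
  classical
  have hP' : 0 < P ^ p := by positivity
  have hc : 0 < (2 : ℝ) ^ t / lam ^ t := by positivity
  rcases eq_or_ne h ∞ with rfl | hh
  · rw [ENNReal.mul_top (by simpa using hc), add_top, ENNReal.mul_top (by simpa using hP')]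
    exact le_top
  have hex : ∃ n : ℕ, h ≤ ENNReal.ofReal ((2 ^ n * lam) ^ t) := by
    obtain ⟨n, hn⟩ := pow_unbounded_of_one_lt (h.toReal ^ (1 / t) / lam) (one_lt_two (α := ℝ))
    refine ⟨n, ?_⟩
    rw [← ENNReal.ofReal_toReal hh]
    apply ENNReal.ofReal_le_ofReal
    rw [div_lt_iff₀ hlam] at hn
    calc h.toReal = (h.toReal ^ (1 / t)) ^ t := by
          rw [← Real.rpow_mul ENNReal.toReal_nonneg, one_div_mul_cancel ht.ne', Real.rpow_one]
      _ ≤ _ := by gcongr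
  have hpow : ∀ n : ℕ, (P * b ^ n) ^ p = P ^ p * (2 ^ t) ^ n := fun n => by
    rw [Real.mul_rpow hP.le (by positivity), ← hbp, ← Real.rpow_natCast, ← Real.rpow_natCast,
      ← Real.rpow_mul hb.le, ← Real.rpow_mul hb.le, mul_comm p]
  have hle : ENNReal.ofReal a ^ p ≤ ENNReal.ofReal (P ^ p * (2 ^ t) ^ Nat.find hex) := by
    rw [ENNReal.ofReal_rpow_of_nonneg ha hp.le, ← hpow]
    exact ENNReal.ofReal_le_ofReal
      (Real.rpow_le_rpow ha (H _ (Nat.find_spec hex)) hp.le)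
  refine hle.trans ?_
  rw [ENNReal.ofReal_mul hP'.le]
  gcongr
  rcases hN : Nat.find hex with _ | m
  · simp
  · have hm : ENNReal.ofReal ((2 ^ m * lam) ^ t) < h :=
      not_le.1 (Nat.find_min hex (by omega))
    refine le_trans ?_ le_add_self
    calc ENNReal.ofReal ((2 ^ t) ^ (m + 1))
        = ENNReal.ofReal (2 ^ t / lam ^ t) * ENNReal.ofReal ((2 ^ m * lam) ^ t) := by
          rw [← ENNReal.ofReal_mul hc.le]
          congr 1
          rw [Real.mul_rpow (by positivity) hlam.le, ← Real.rpow_natCast ((2 : ℝ) ^ t),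
            ← Real.rpow_natCast 2 m, ← Real.rpow_mul two_pos.le, ← Real.rpow_mul two_pos.le]
          have : (2 : ℝ) ^ (t * ((m + 1 : ℕ) : ℝ)) = 2 ^ t * 2 ^ ((m : ℝ) * t) := by
            rw [← Real.rpow_add two_pos]; congr 1; push_cast; ring
          rw [this]
          have := (Real.rpow_pos_of_pos hlam t).ne'
          field_simp
      _ ≤ _ := by gcongr

/-- Sobolev–Poincaré inequality at a level `lam` which exceeds the average of `H` over `B`. -/
theorem iInf_average_rpow_le_of_lintegral_lt {X : Type*} [MeasurableSpace X] {μ : Measure X}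
    {ρ : X → X → ℝ} {x : X} {B Ω E : Set X} {u : X → ℝ} {H : X → ℝ≥0∞} {t α r lam A G Q c : ℝ}
    (hα : 0 < α) (hr : 0 < r) (hlam : 0 < lam) (hA : 1 ≤ A) (hG : 0 < G) (ht : 0 < t)
    (hQ : 0 < Q) (hc : 0 < c) (htQ : α * t < Q) (hρ : ∀ x y, 0 ≤ ρ x y)
    (htri : ∀ y z z', ρ z z' ≤ A * max (ρ y z) (ρ y z'))
    (hdiam : ∀ y ∈ B, ∀ z ∈ B, ρ y z ≤ A * r)
    (hE : μ E = 0) (hH : AEMeasurable H μ) (hB : μ B ≠ 0) (hB' : μ B ≠ ∞)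
    (hxS : x ∈ qball ρ x r ∩ Ω) (hSm : MeasurableSet (qball ρ x r ∩ Ω))
    (hgrad : ∀ y ∈ (B ∩ Ω) \ E, ∀ z ∈ (B ∩ Ω) \ E, ∀ a : ℝ, 0 ≤ a →
      H y ≤ ENNReal.ofReal (a ^ t) → H z ≤ ENNReal.ofReal (a ^ t) →
      |u y - u z| ≤ G * a * ρ y z ^ α)
    (hsub : ∀ y ∈ qball ρ x r, qball ρ y r ⊆ B)
    (hlow : ∀ y ∈ qball ρ x r ∩ Ω, ∀ w : ℝ, 0 < w → w ≤ 1 →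
      ENNReal.ofReal (c * w ^ Q) * μ B ≤ μ (qball ρ y (r * w) ∩ Ω))
    (hI : ∫⁻ y in B, H y ∂μ < ENNReal.ofReal (c * lam ^ t) * μ B) :
    (⨅ γ : ℝ, ((∫⁻ y in qball ρ x r ∩ Ω, ENNReal.ofReal |u y - γ| ^ (Q * t / (Q - α * t)) ∂μ) /
        μ (qball ρ x r ∩ Ω)) ^ (1 / (Q * t / (Q - α * t)))) ≤
      ENNReal.ofReal (2 * G * lam * (A * r) ^ α *
        (1 / (2 * ((2 : ℝ) ^ (-(t / Q))) ^ α - 1) + 2) *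
        (1 + 2 ^ t) ^ (1 / (Q * t / (Q - α * t)))) := by
  set p := Q * t / (Q - α * t) with hp_def
  set w : ℝ := (2 : ℝ) ^ (-(t / Q)) with hw_def
  set S₀ := qball ρ x r ∩ Ω with hS₀
  have hQt : 0 < Q - α * t := by linarith
  have hp : 0 < p := by positivity
  have hA0 : 0 < A := by linarith
  have hw : 0 < w := by positivity
  have hw1 : w < 1 := Real.rpow_lt_one_of_one_lt_of_neg one_lt_two (by simp; positivity)
  have hbeq : 2 * w ^ α = (2 : ℝ) ^ (1 - t / Q * α) := by
    rw [hw_def, ← Real.rpow_mul two_pos.le, sub_eq_add_neg, Real.rpow_add two_pos, Real.rpow_one,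
      neg_mul]
  have hθ : 0 < 1 - t / Q * α := by
    rw [sub_pos, div_mul_eq_mul_div, div_lt_one hQ]; linarith
  have hb : 1 < 2 * w ^ α := by
    rw [hbeq]; exact Real.one_lt_rpow one_lt_two hθ
  have hbp : (2 * w ^ α) ^ p = 2 ^ t := by
    rw [hbeq, ← Real.rpow_mul two_pos.le]
    congr 1
    have : Q - t * α ≠ 0 := by rw [mul_comm]; exact hQt.ne'
    rw [hp_def, mul_comm α t]
    field_simp
  set P := 2 * G * lam * (A * r) ^ α * (1 / (2 * w ^ α - 1) + 2) with hP_def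
  have hP : 0 < P := by
    have : 0 < 2 * w ^ α - 1 := by linarith
    positivity
  have hSB : S₀ ⊆ B := fun y hy => hsub x hxS.1 hy.1
  have hSlow : ENNReal.ofReal c * μ B ≤ μ S₀ := by
    simpa using hlow x hxS 1 one_pos le_rfl
  have hSpos : μ S₀ ≠ 0 := by
    refine (lt_of_lt_of_le ?_ hSlow).ne'
    exact ENNReal.mul_pos (by simpa using hc) hB
  have hStop : μ S₀ ≠ ∞ := ((measure_mono hSB).trans_lt hB'.lt_top).ne
  have hSne : (S₀ \ E).Nonempty := by
    apply nonempty_of_measure_ne_zero (μ := μ)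
    rwa [measure_sdiff_null hE]
  have hnear : ∀ y ∈ S₀ \ E, ∀ i : ℕ, ∃ z ∈ (B ∩ Ω) \ E, ρ y z < r * w ^ i ∧
      H z ≤ ENNReal.ofReal ((2 ^ i * lam) ^ t) := by
    intro y hy i
    by_contra! hcon
    set a := ENNReal.ofReal ((2 ^ i * lam) ^ t)
    have hwi : w ^ i ≤ 1 := pow_le_one₀ hw.le hw1.le
    have hincl : qball ρ y (r * w ^ i) ∩ Ω ⊆ ({z | a ≤ H z} ∩ B) ∪ E := by
      rintro z ⟨hz, hzΩ⟩
      by_cases hzE : z ∈ E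
      · exact Or.inr hzE
      · have hzB : z ∈ B := hsub y hy.1.1
          (lt_of_lt_of_le hz (mul_le_of_le_one_right hr.le hwi))
        exact Or.inl ⟨(hcon z ⟨⟨hzB, hzΩ⟩, hzE⟩ hz).le, hzB⟩
    have h1 : ENNReal.ofReal (c * (w ^ i) ^ Q) * μ B ≤ μ.restrict B {z | a ≤ H z} :=
      calc _ ≤ μ (qball ρ y (r * w ^ i) ∩ Ω) := hlow y hy.1 _ (by positivity) hwi
        _ ≤ μ (({z | a ≤ H z} ∩ B) ∪ E) := measure_mono hincl
        _ ≤ μ ({z | a ≤ H z} ∩ B) + μ E := measure_union_le _ _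
        _ ≤ _ := by rw [hE, add_zero]; exact Measure.le_restrict_apply _ _
    have h2 : a * μ.restrict B {z | a ≤ H z} ≤ ∫⁻ y in B, H y ∂μ :=
      mul_meas_ge_le_lintegral₀ hH.restrict a
    refine absurd hI (not_lt.2 (le_trans (le_of_eq ?_) ((mul_le_mul_right h1 a).trans h2)))
    rw [← mul_assoc, ← ENNReal.ofReal_mul (by positivity)]
    congr 2
    have : (2 : ℝ) ^ ((i : ℝ) * t) * (w ^ i) ^ Q = 1 := by
      rw [hw_def, ← Real.rpow_natCast, ← Real.rpow_mul two_pos.le, ← Real.rpow_mul two_pos.le,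
        ← Real.rpow_add two_pos]
      rw [show (i : ℝ) * t + -(t / Q) * i * Q = 0 by field_simp; ring, Real.rpow_zero]
    rw [Real.mul_rpow (by positivity) hlam.le, ← Real.rpow_natCast 2 i,
      ← Real.rpow_mul two_pos.le]
    linear_combination (-(c * lam ^ t)) * this
  obtain ⟨γ, hγ⟩ := exists_const_abs_sub_le_of_near (S := S₀ \ E) (D := (B ∩ Ω) \ E)
    hα hr hlam hA hG hw hw1 hb ht hSne (fun y hy => ⟨⟨hSB hy.1, hy.1.2⟩, hy.2⟩) hρ htri
    (fun y hy z hz => hdiam y hy.1.1 z hz.1.1) hgrad hnear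
  have hpt : ∀ y ∈ S₀ \ E, ENNReal.ofReal |u y - γ| ^ p ≤
      ENNReal.ofReal (P ^ p) * (1 + ENNReal.ofReal (2 ^ t / lam ^ t) * H y) := fun y hy =>
    ofReal_rpow_le_of_geometric (abs_nonneg _) hP hlam ht hp (by linarith) hbp (hγ y hy)
  have hEae : ∀ᵐ y ∂μ, y ∉ E := measure_eq_zero_iff_ae_notMem.1 hE
  have hint : ∫⁻ y in S₀, ENNReal.ofReal |u y - γ| ^ p ∂μ ≤
      ENNReal.ofReal (P ^ p * (1 + 2 ^ t)) * μ S₀ :=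
    calc _ ≤ ∫⁻ y in S₀, ENNReal.ofReal (P ^ p) *
            (1 + ENNReal.ofReal (2 ^ t / lam ^ t) * H y) ∂μ := by
          refine setLIntegral_mono_ae' hSm ?_
          filter_upwards [hEae] with y hy hyS using hpt y ⟨hyS, hy⟩
      _ = ENNReal.ofReal (P ^ p) *
            (μ S₀ + ENNReal.ofReal (2 ^ t / lam ^ t) * ∫⁻ y in S₀, H y ∂μ) := by
          rw [lintegral_const_mul' _ _ ENNReal.ofReal_ne_top, lintegral_add_left measurable_const,
            lintegral_const_mul' _ _ ENNReal.ofReal_ne_top]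
          simp
      _ ≤ ENNReal.ofReal (P ^ p) * (μ S₀ + ENNReal.ofReal (2 ^ t) * μ S₀) := by
          gcongr ENNReal.ofReal (P ^ p) * (μ S₀ + ?_)
          calc _ ≤ ENNReal.ofReal (2 ^ t / lam ^ t) * (ENNReal.ofReal (c * lam ^ t) * μ B) := by
                gcongr
                exact (lintegral_mono_set hSB).trans hI.le
            _ = ENNReal.ofReal (2 ^ t) * (ENNReal.ofReal c * μ B) := by
                rw [← mul_assoc, ← mul_assoc, ← ENNReal.ofReal_mul (by positivity),
                  ← ENNReal.ofReal_mul (by positivity)]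
                congr 2
                have := (Real.rpow_pos_of_pos hlam t).ne'
                field_simp
            _ ≤ _ := by gcongr
      _ = _ := by
          rw [ENNReal.ofReal_mul (by positivity), ENNReal.ofReal_add one_pos.le (by positivity),
            ENNReal.ofReal_one]
          ring
  refine (iInf_le _ γ).trans ?_
  have hfin : ENNReal.ofReal (P * (1 + 2 ^ t) ^ (1 / p)) =
      ENNReal.ofReal (P ^ p * (1 + 2 ^ t)) ^ (1 / p) := by
    rw [ENNReal.ofReal_rpow_of_nonneg (by positivity) (by positivity),
      Real.mul_rpow (by positivity) (by positivity), ← Real.rpow_mul hP.le,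
      mul_one_div_cancel hp.ne', Real.rpow_one]
  rw [hfin]
  gcongr
  exact ENNReal.div_le_of_le_mul hint

theorem le_ofReal_mul_rpow_of_forall_lt {a I M : ℝ≥0∞} {K c t : ℝ} (hK : 0 < K) (hc : 0 < c)
    (ht : 0 < t) (hM : M ≠ 0) (hM' : M ≠ ∞)
    (h : ∀ lam : ℝ, 0 < lam → I < ENNReal.ofReal (c * lam ^ t) * M →
      a ≤ ENNReal.ofReal (K * lam)) :
    a ≤ ENNReal.ofReal (K * (1 / c) ^ (1 / t)) * (I / M) ^ (1 / t) := by
  have hcK : 0 < K * (1 / c) ^ (1 / t) := by positivity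
  have ht' : 0 < 1 / t := by positivity
  rcases eq_or_ne I ∞ with rfl | hI
  · rw [ENNReal.top_div_of_ne_top hM', ENNReal.top_rpow_of_pos ht',
      ENNReal.mul_top (by simpa using hcK)]
    exact le_top
  have hv : I / M ≠ ∞ := ENNReal.div_ne_top hI hM
  set v := (I / M).toReal with hv_def
  have hv0 : 0 ≤ v := ENNReal.toReal_nonneg
  have hIv : I / M = ENNReal.ofReal v := (ENNReal.ofReal_toReal hv).symm
  have hδ : ∀ δ : ℝ, 0 < δ → a ≤ ENNReal.ofReal (K * ((v + δ) * (1 / c)) ^ (1 / t)) := by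
    intro δ hδ
    refine h _ (by positivity) ?_
    rw [← Real.rpow_mul (by positivity), one_div_mul_cancel ht.ne', Real.rpow_one,
      show c * ((v + δ) * (1 / c)) = v + δ by field_simp]
    rw [← ENNReal.div_lt_iff (Or.inl hM) (Or.inl hM'), hIv,
      ENNReal.ofReal_lt_ofReal_iff (by positivity)]
    linarith
  have hcont : Continuous fun δ : ℝ => ENNReal.ofReal (K * ((v + δ) * (1 / c)) ^ (1 / t)) := by
    refine ENNReal.continuous_ofReal.comp (continuous_const.mul ?_)
    exact ((continuous_const.add continuous_id).mul continuous_const).rpow_const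
      fun _ => Or.inr ht'.le
  have hlim := (hcont.tendsto 0).mono_left (nhdsWithin_le_nhds (s := Ioi 0))
  have hle := ge_of_tendsto hlim (Filter.eventually_of_mem self_mem_nhdsWithin hδ)
  refine hle.trans (le_of_eq ?_)
  rw [hIv, ENNReal.ofReal_rpow_of_nonneg hv0 ht'.le, ← ENNReal.ofReal_mul hcK.le, add_zero,
    Real.mul_rpow hv0 (by positivity)]
  congr 1
  ring

/-- On a set of small diameter, a fractional `s`-gradient yields a pointwise Hölder-type bound in
terms of the weighted supremum of its components. -/
theorem abs_sub_le_of_fracGrad_bound {X : Type*} {ρ : X → X → ℝ} {u : X → ℝ} {g : ℤ → X → ℝ}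
    {y z : X} {s ε ε' t a R : ℝ} {m : ℤ} (hρ : 0 ≤ ρ y z) (hρ0 : ρ y z = 0 → y = z)
    (hg : ∀ k x, 0 ≤ g k x)
    (hgrad : ∀ k : ℤ, (2 : ℝ) ^ (-k - 1) ≤ ρ y z → ρ y z < (2 : ℝ) ^ (-k) →
      |u y - u z| ≤ ρ y z ^ s * (g k y + g k z))
    (ht : 0 < t) (hε'ε : ε' < ε) (hεs : ε < s) (ha : 0 ≤ a)
    (hR : ρ y z ≤ R) (hm : ρ y z < (2 : ℝ) ^ (-m))
    (hy : ∀ j, m ≤ j → (2 : ℝ) ^ (-(j : ℝ) * (s - ε) * t) * g j y ^ t ≤ a ^ t)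
    (hz : ∀ j, m ≤ j → (2 : ℝ) ^ (-(j : ℝ) * (s - ε) * t) * g j z ^ t ≤ a ^ t) :
    |u y - u z| ≤ 2 * R ^ (ε - ε') * a * ρ y z ^ ε' := by
  have hR0 : 0 ≤ R := hρ.trans hR
  rcases hρ.eq_or_lt with h0 | hpos
  · have h1 : |u y - u z| = 0 := by rw [hρ0 h0.symm, sub_self, abs_zero]
    rw [h1]
    positivity
  obtain ⟨k, hk1, hk2⟩ := exists_mem_Ico_zpow hpos (one_lt_two (α := ℝ))
  obtain ⟨j, rfl⟩ : ∃ j : ℤ, k = -j - 1 := ⟨-k - 1, by ring⟩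
  rw [show -j - 1 + 1 = -j by ring] at hk2
  have hj : m ≤ j := by
    have := (zpow_lt_zpow_iff_right₀ (one_lt_two (α := ℝ))).1 (hk1.trans_lt hm)
    omega
  have hroot : ∀ b : ℝ, 0 ≤ b → (2 : ℝ) ^ (-(j : ℝ) * (s - ε) * t) * b ^ t ≤ a ^ t →
      (2 : ℝ) ^ (-(j : ℝ) * (s - ε)) * b ≤ a := fun b hb h => by
    rw [Real.rpow_mul two_pos.le, ← Real.mul_rpow (by positivity) hb] at h
    exact (Real.rpow_le_rpow_iff (by positivity) ha ht).1 h
  have hy' := hroot _ (hg j y) (hy j hj)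
  have hz' := hroot _ (hg j z) (hz j hj)
  have h1 : ρ y z ^ (s - ε) ≤ (2 : ℝ) ^ (-(j : ℝ) * (s - ε)) := by
    rw [Real.rpow_mul two_pos.le]
    have : (2 : ℝ) ^ (-(j : ℝ)) = (2 : ℝ) ^ (-j) := by rw [← Real.rpow_intCast]; norm_cast
    rw [this]
    exact Real.rpow_le_rpow hρ hk2.le (by linarith)
  have hgyz : 0 ≤ g j y + g j z := add_nonneg (hg j y) (hg j z)
  calc |u y - u z| ≤ ρ y z ^ s * (g j y + g j z) := hgrad j hk1 hk2
    _ = ρ y z ^ ε' * ρ y z ^ (ε - ε') * (ρ y z ^ (s - ε) * (g j y + g j z)) := by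
        rw [show s = ε' + (ε - ε') + (s - ε) by ring, Real.rpow_add hpos, Real.rpow_add hpos,
          show ε' + (ε - ε') + (s - ε) - ε = s - ε by ring]
        ring
    _ ≤ ρ y z ^ ε' * R ^ (ε - ε') *
          ((2 : ℝ) ^ (-(j : ℝ) * (s - ε)) * (g j y + g j z)) := by
        gcongr
    _ ≤ ρ y z ^ ε' * R ^ (ε - ε') * (2 * a) := by
        gcongr ρ y z ^ ε' * R ^ (ε - ε') * ?_
        linarith
    _ = _ := by ring

/-- Lemma 3.5: a Sobolev–Poincaré type inequality on domains satisfying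
the measure density condition, in terms of fractional `s`-gradients. -/
theorem poincare_fracGrad
    {X : Type*} [MeasurableSpace X] (ρ : X → X → ℝ) (μ : Measure X)
    (hX : IsQMMS ρ μ) (Q : ℝ) (hQ : 0 < Q) (hdoub : QDoubling ρ μ Q)
    (Ω : Set X) (hΩmeas : MeasurableSet Ω) (hΩne : Ω.Nonempty)
    (hdens : MeasDensity ρ μ Ω)
    (t s ε ε' : ℝ) (ht : 0 < t) (hs : 0 < s) (hε' : 0 < ε')
    (htQ : t < Q / ε') (hε'ε : ε' < ε) (hεs : ε < s)
    (k₀ : ℕ) (hk₀ : Crho ρ ^ 2 * CrhoTilde ρ ≤ 2 ^ k₀) :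
    ∀ rstar : ℝ, 1 ≤ rstar → ∃ C : ℝ, 0 < C ∧
      ∀ (u : X → ℝ), AEMeasurable u (μ.restrict Ω) →
      ∀ g ∈ fracGrad ρ μ Ω s u, ∀ x ∈ Ω, ∀ L : ℤ, (2 : ℝ) ^ (-L) ≤ rstar →
        (⨅ γ : ℝ,
            ((∫⁻ y in qball ρ x ((2 : ℝ) ^ (-L)) ∩ Ω,
                ENNReal.ofReal |u y - γ| ^ (Q * t / (Q - ε' * t)) ∂μ) /
              μ (qball ρ x ((2 : ℝ) ^ (-L)) ∩ Ω)) ^ (1 / (Q * t / (Q - ε' * t)))) ≤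
          ENNReal.ofReal (C * (2 : ℝ) ^ (-(L : ℝ) * ε)) *
            ((∫⁻ y in qball ρ x (Crho ρ * (2 : ℝ) ^ (-L)),
                (⨆ j : ℤ, ⨆ _ : L - (k₀ : ℤ) ≤ j,
                  ENNReal.ofReal ((2 : ℝ) ^ (-(j : ℝ) * (s - ε) * t) *
                    (Set.indicator Ω (g j) y) ^ t)) ∂μ) /
              μ (qball ρ x (Crho ρ * (2 : ℝ) ^ (-L)))) ^ (1 / t) := by
  intro rstar hrstar
  obtain ⟨κ, hκ, hdbl⟩ := hdoub
  obtain ⟨c, hc, hden⟩ := hdens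
  obtain ⟨hC1, hCtri⟩ := crho_spec hX.quasi
  obtain ⟨hT1, hTsym⟩ := crhoTilde_spec hX.quasi
  obtain ⟨hρ, hρ0, -, -⟩ := hX.quasi
  have htQ' : ε' * t < Q := by rwa [lt_div_iff₀ hε', mul_comm] at htQ
  set C₁ := Crho ρ
  set T := CrhoTilde ρ
  set A := C₁ ^ 2 * T with hA_def
  have hC0 : 0 < C₁ := by linarith
  have hT0 : 0 < T := by linarith
  have hA : 1 ≤ A := one_le_mul_of_one_le_of_one_le (one_le_pow₀ hC1) hT1
  have hA0 : 0 < A := by linarith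
  have hrs : 0 < rstar := by linarith
  set c₀ := κ * (1 / (rstar * C₁)) ^ Q / c with hc₀_def
  have hc₀ : 0 < c₀ := by positivity
  set Z := (1 / (2 * ((2 : ℝ) ^ (-(t / Q))) ^ ε' - 1) + 2) *
        (1 + 2 ^ t) ^ (1 / (Q * t / (Q - ε' * t))) with hZ_def
  have hZ : 0 < Z := by
    have hb : 1 < 2 * ((2 : ℝ) ^ (-(t / Q))) ^ ε' := by
      have heq : 2 * ((2 : ℝ) ^ (-(t / Q))) ^ ε' = (2 : ℝ) ^ (1 - t / Q * ε') := by
        rw [← Real.rpow_mul two_pos.le, sub_eq_add_neg, Real.rpow_add two_pos, Real.rpow_one,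
          neg_mul]
      rw [heq]
      refine Real.one_lt_rpow one_lt_two ?_
      rw [sub_pos, div_mul_eq_mul_div, div_lt_one hQ]; linarith
    have : 0 < 2 * ((2 : ℝ) ^ (-(t / Q))) ^ ε' - 1 := by linarith
    positivity
  refine ⟨4 * A ^ ε * Z * (1 / c₀) ^ (1 / t), by positivity, ?_⟩
  rintro u - g ⟨hg0, hgm, E, hE, hgE⟩ x hx L hL
  set r : ℝ := (2 : ℝ) ^ (-L) with hr_def
  have hr : 0 < r := by positivity
  have hrε : (2 : ℝ) ^ (-(L : ℝ) * ε) = r ^ ε := by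
    rw [Real.rpow_mul two_pos.le, hr_def, ← Real.rpow_intCast]; norm_cast
  set B := qball ρ x (C₁ * r) with hB_def
  set H : X → ℝ≥0∞ := fun y => ⨆ j : ℤ, ⨆ _ : L - (k₀ : ℤ) ≤ j,
    ENNReal.ofReal ((2 : ℝ) ^ (-(j : ℝ) * (s - ε) * t) * (Set.indicator Ω (g j) y) ^ t) with hH_def
  have hHm : AEMeasurable H μ := by
    refine AEMeasurable.iSup fun j => AEMeasurable.iSup fun _ => ?_
    exact ((((aemeasurable_indicator_iff hΩmeas).2 (hgm j)).pow_const t).const_mul _).ennreal_ofReal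
  have hHle : ∀ y ∈ Ω, ∀ a : ℝ, 0 ≤ a → H y ≤ ENNReal.ofReal (a ^ t) →
      ∀ j, L - (k₀ : ℤ) ≤ j → (2 : ℝ) ^ (-(j : ℝ) * (s - ε) * t) * g j y ^ t ≤ a ^ t := by
    intro y hy a ha h j hj
    have h1 := (le_iSup₂ (f := fun (j : ℤ) (_ : L - (k₀ : ℤ) ≤ j) =>
      ENNReal.ofReal ((2 : ℝ) ^ (-(j : ℝ) * (s - ε) * t) * (Set.indicator Ω (g j) y) ^ t))
      j hj).trans h
    rwa [ENNReal.ofReal_le_ofReal_iff (by positivity), indicator_of_mem hy] at h1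
  have htri : ∀ y z z', ρ z z' ≤ C₁ * T * max (ρ y z) (ρ y z') := by
    intro y z z'
    rw [mul_assoc]
    refine (hCtri z z' y).trans ?_
    gcongr
    refine max_le ((hTsym y z).trans (by gcongr; exact le_max_left _ _)) ?_
    exact (le_max_right _ _).trans
      (le_mul_of_one_le_left (le_max_of_le_left (hρ _ _)) hT1)
  have hAeq : A = C₁ * T * C₁ := by rw [hA_def]; ring
  have hdiam : ∀ y ∈ B, ∀ z ∈ B, ρ y z < A * r := by
    intro y hy z hz
    refine (htri x y z).trans_lt ?_
    rw [hAeq, mul_assoc (C₁ * T)]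
    exact mul_lt_mul_of_pos_left (max_lt hy hz) (by positivity)
  have hsub : ∀ y ∈ qball ρ x r, qball ρ y r ⊆ B := by
    intro y hy z hz
    exact (hCtri x z y).trans_lt (mul_lt_mul_of_pos_left (max_lt hy hz) hC0)
  have hlow : ∀ y ∈ qball ρ x r ∩ Ω, ∀ w : ℝ, 0 < w → w ≤ 1 →
      ENNReal.ofReal (c₀ * w ^ Q) * μ B ≤ μ (qball ρ y (r * w) ∩ Ω) := by
    intro y hy w hw hw1
    have hwr : r * w / rstar ≤ r * w := div_le_self (by positivity) hrstar
    have hwr' : r * w ≤ r := mul_le_of_le_one_right hr.le hw1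
    have hmono : qball ρ y (r * w / rstar) ⊆ qball ρ y (r * w) := fun z hz =>
      lt_of_lt_of_le hz hwr
    have h1 := hdbl y x (r * w / rstar) (C₁ * r) (by positivity)
      (hwr.trans (hwr'.trans (le_mul_of_one_le_left hr.le hC1)))
      ((hmono.trans fun z hz => lt_of_lt_of_le hz hwr').trans (hsub y hy.1))
    have h2 := hden y hy.2 (r * w / rstar) (by positivity)
      ((div_le_one hrs).2 (hwr'.trans hL))
    have h3 : ENNReal.ofReal c * (ENNReal.ofReal (c₀ * w ^ Q) * μ B) ≤
        ENNReal.ofReal c * μ (qball ρ y (r * w) ∩ Ω) := by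
      refine le_trans (le_of_eq ?_) (h1.trans (h2.trans ?_))
      · rw [← mul_assoc, ← ENNReal.ofReal_mul hc.le]
        congr 2
        rw [hc₀_def, show r * w / rstar / (C₁ * r) = 1 / (rstar * C₁) * w by field_simp,
          Real.mul_rpow (by positivity) hw.le]
        field_simp
      · gcongr
    exact (ENNReal.mul_le_mul_iff_right (by simpa using hc) ENNReal.ofReal_ne_top).1 h3
  have hCr : 0 < C₁ * r := by positivity
  have hMpos : μ B ≠ 0 := (hX.ball_pos x _ hCr).ne'
  have hMtop : μ B ≠ ∞ := (hX.ball_lt_top x _ hCr).ne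
  have hxball : x ∈ qball ρ x r := by
    change ρ x x < r
    rwa [(hρ0 x x).2 rfl]
  have hkey : ∀ lam : ℝ, 0 < lam →
      ∫⁻ y in B, H y ∂μ < ENNReal.ofReal (c₀ * lam ^ t) * μ B → _ := fun lam hlam hI =>
    iInf_average_rpow_le_of_lintegral_lt (u := u) (E := E) (Ω := Ω) (x := x) (A := A)
      (G := 2 * (A * r) ^ (ε - ε'))
      hε' hr hlam hA (by positivity) ht hQ hc₀ htQ' hρ
      (fun y z z' => (htri y z z').trans (mul_le_mul_of_nonneg_right
        (hAeq ▸ le_mul_of_one_le_right (by positivity) hC1) (le_max_of_le_left (hρ _ _))))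
      (fun y hy z hz => (hdiam y hy z hz).le) hE hHm hMpos hMtop ⟨hxball, hx⟩
      ((hX.measurableSet_ball x r hr).inter hΩmeas)
      (fun y hy z hz a ha hya hza => abs_sub_le_of_fracGrad_bound (m := L - k₀) (hρ y z)
        (hρ0 y z).1 hg0 (fun k => hgE k y ⟨hy.1.2, hy.2⟩ z ⟨hz.1.2, hz.2⟩) ht hε'ε hεs ha
        (hdiam y hy.1.1 z hz.1.1).le
        ((hdiam y hy.1.1 z hz.1.1).trans_le (by
          rw [neg_sub, sub_eq_add_neg, zpow_add₀ two_ne_zero, zpow_natCast]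
          gcongr))
        (hHle y hy.1.2 a ha hya) (hHle z hz.1.2 a ha hza))
      hsub hlow hI
  have hfinal := le_ofReal_mul_rpow_of_forall_lt (K := 4 * A ^ ε * Z * r ^ ε) (by positivity) hc₀
    ht hMpos hMtop fun lam hlam hI => (hkey lam hlam hI).trans (le_of_eq (by
      congr 1
      have h1 : (A * r) ^ (ε - ε') * (A * r) ^ ε' = A ^ ε * r ^ ε := by
        rw [← Real.rpow_add (by positivity), sub_add_cancel, Real.mul_rpow hA0.le hr.le]
      rw [hZ_def]
      linear_combination (4 * lam * Z) * h1))
  refine hfinal.trans (le_of_eq ?_)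
  rw [hrε]
  congr 2
  ring

end HajlaszPaper
end
end

section
/- Let (X,ρ,μ) be a quasi-metric measure space with μ doubling, and let Ω ⊂ X be a nonempty μ-measurable set satisfying the measure density condition. Fix t,s,ε ∈ (0,∞) with ε < s, a constant c ≥ 1, and k₀ ∈ ℕ with 2^{k₀} ≥ C_ρ² C̃_ρ. Then for every r* ∈ [1,∞) there is a constant C > 0 such that: for every μ-measurable u: Ω→ℝ, every fractional s-gradient (g_k)_{k∈ℤ} ∈ 𝔻^s_ρ(u) (extended by g_k ≡ 0 on X∖Ω), every x ∈ Ω, every L ∈ ℤ with 2^{−L} ≤ r*, and every ρ-ball B ⊂ B_ρ(x,2^{−L}) centered in Ω with μ(B_ρ(x,2^{−L})∩Ω) ≤ c μ(B∩Ω), one has |m_u(B∩Ω) − m_u(B_ρ(x,2^{−L})∩Ω)| ≤ C 2^{−Lε} ( ⨍_{B_ρ(x,C_ρ 2^{−L})} sup_{j ≥ L−k₀} { 2^{−j(s−ε)t} g_j^t } dμ )^{1/t}. -/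
open MeasureTheory ENNReal Set

noncomputable section

namespace HajlaszPaper

variable {X : Type*}

variable [MeasurableSpace X]

theorem le_sInf_mul {S : Set ℝ} (hS : S.Nonempty) {a m : ℝ} (hm : 0 ≤ m)
    (h : ∀ C ∈ S, a ≤ C * m) : a ≤ sInf S * m := by
  rcases hm.eq_or_lt with rfl | hm
  · obtain ⟨C, hC⟩ := hS
    simpa using h C hC
  · rw [← div_le_iff₀ hm]
    exact le_csInf hS fun C hC => (div_le_iff₀ hm).2 (h C hC)

namespace IsQuasiDist

variable {Y : Type*} {ρ : Y → Y → ℝ}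

theorem one_le_Crho (h : IsQuasiDist ρ) : 1 ≤ Crho ρ :=
  le_csInf h.2.2.2 fun _ hC => hC.1

theorem le_Crho_mul_max (h : IsQuasiDist ρ) (x y z : Y) :
    ρ x y ≤ Crho ρ * max (ρ x z) (ρ z y) :=
  le_sInf_mul h.2.2.2 (le_max_of_le_left (h.1 x z)) fun _ hC => hC.2 x y z

theorem one_le_CrhoTilde (h : IsQuasiDist ρ) : 1 ≤ CrhoTilde ρ :=
  le_csInf h.2.2.1 fun _ hC => hC.1

theorem le_CrhoTilde_mul (h : IsQuasiDist ρ) (x y : Y) : ρ y x ≤ CrhoTilde ρ * ρ x y :=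
  le_sInf_mul h.2.2.1 (h.1 x y) fun _ hC => hC.2 x y

/-- Two points of a ball of radius `r` are at distance less than `C_ρ C̃_ρ r`. -/
theorem lt_of_mem_qball (h : IsQuasiDist ρ) {x z w : Y} {r : ℝ} (hz : z ∈ qball ρ x r)
    (hw : w ∈ qball ρ x r) : ρ z w < Crho ρ * CrhoTilde ρ * r := by
  have hr : 0 < r := (h.1 x z).trans_lt hz
  have h1 := h.one_le_Crho
  have h2 := h.one_le_CrhoTilde
  have hzx : ρ z x < CrhoTilde ρ * r :=
    (h.le_CrhoTilde_mul x z).trans_lt (mul_lt_mul_of_pos_left hz (by linarith))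
  have hxw : ρ x w < CrhoTilde ρ * r := lt_of_lt_of_le hw (by nlinarith)
  rw [mul_assoc]
  exact (h.le_Crho_mul_max z w x).trans_lt
    (mul_lt_mul_of_pos_left (max_lt hzx hxw) (by linarith))

end IsQuasiDist

theorem qball_mono {Y : Type*} {ρ : Y → Y → ℝ} {x : Y} {r R : ℝ} (h : r ≤ R) :
    qball ρ x r ⊆ qball ρ x R :=
  fun _ hz => lt_of_lt_of_le hz h

/-- If `u` deviates from `a` by at most `D` on more than half of `E`, so does its median. -/
theorem abs_medianVal_sub_le {μ : Measure X} {E : Set X} {u : X → ℝ} {a D : ℝ}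
    (hE : μ E ≠ ∞) (h : μ {z ∈ E | ¬ |u z - a| ≤ D} < μ E / 2) :
    |medianVal μ E u - a| ≤ D := by
  have hlow : a - D ∈ {θ : ℝ | μ {x ∈ E | u x < θ} ≤ μ E / 2} := by
    refine (measure_mono ?_).trans h.le
    rintro z ⟨hz, hlt⟩
    refine ⟨hz, fun hle => ?_⟩
    linarith [(abs_le.1 hle).1]
  have hup : ∀ θ ∈ {θ : ℝ | μ {x ∈ E | u x < θ} ≤ μ E / 2}, θ ≤ a + D := by
    intro θ hθ
    by_contra! hlt
    have hsub : E ⊆ {x ∈ E | u x < θ} ∪ {z ∈ E | ¬ |u z - a| ≤ D} := by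
      intro z hz
      by_cases hle : |u z - a| ≤ D
      · exact Or.inl ⟨hz, by linarith [(abs_le.1 hle).2]⟩
      · exact Or.inr ⟨hz, hle⟩
    have hcontra : μ E < μ E := calc
      μ E ≤ μ {x ∈ E | u x < θ} + μ {z ∈ E | ¬ |u z - a| ≤ D} :=
        (measure_mono hsub).trans (measure_union_le _ _)
      _ < μ E / 2 + μ E / 2 :=
        ENNReal.add_lt_add_of_le_of_lt (ne_top_of_le_ne_top (ENNReal.div_ne_top hE (by simp)) hθ)
          hθ h
      _ = μ E := ENNReal.add_halves _
    exact hcontra.false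
  rw [abs_le]
  constructor
  · linarith [le_csSup ⟨a + D, hup⟩ hlow, show medianVal μ E u = sSup _ from rfl]
  · linarith [csSup_le ⟨_, hlow⟩ hup, show medianVal μ E u = sSup _ from rfl]

theorem DoublingMeas.exists_measure_le {ρ : X → X → ℝ} {μ : Measure X} (h : DoublingMeas ρ μ)
    (n : ℕ) : ∃ K : ℝ, 0 < K ∧ ∀ (x : X) (r : ℝ), 0 < r →
      μ (qball ρ x (2 ^ n * r)) ≤ ENNReal.ofReal K * μ (qball ρ x r) := by
  obtain ⟨Cd, hCd, hd⟩ := h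
  refine ⟨Cd ^ n, by positivity, fun x r hr => ?_⟩
  induction n with
  | zero => simp
  | succ n ih =>
    rw [pow_succ', mul_assoc, pow_succ', ENNReal.ofReal_mul hCd.le, mul_assoc]
    exact (hd x _ (by positivity)).trans (by gcongr)

/-- Under doubling and measure density, `Ω` occupies a fixed proportion of the enlargement
`B(x, λ r)` of any ball `B(x, r)` centered in `Ω` with `r ≤ R`. -/
theorem MeasDensity.exists_measure_le {ρ : X → X → ℝ} {μ : Measure X} {Ω : Set X}
    (hdens : MeasDensity ρ μ Ω) (hdoub : DoublingMeas ρ μ) (lam : ℝ) {R : ℝ} (hR : 1 ≤ R) :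
    ∃ K : ℝ, 0 < K ∧ ∀ x ∈ Ω, ∀ r : ℝ, 0 < r → r ≤ R →
      μ (qball ρ x (lam * r)) ≤ ENNReal.ofReal K * μ (qball ρ x r ∩ Ω) := by
  obtain ⟨c, hc, hdens⟩ := hdens
  obtain ⟨n, hn⟩ := pow_unbounded_of_one_lt (lam * R) (one_lt_two (α := ℝ))
  obtain ⟨K, hK, hdoub⟩ := hdoub.exists_measure_le n
  refine ⟨K * c, by positivity, fun x hx r hr hrR => ?_⟩
  have hR0 : 0 < R := by linarith
  have hle : lam * r ≤ 2 ^ n * (r / R) := by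
    rw [mul_div_assoc', le_div_iff₀ hR0]
    nlinarith
  calc μ (qball ρ x (lam * r)) ≤ μ (qball ρ x (2 ^ n * (r / R))) := measure_mono (qball_mono hle)
    _ ≤ ENNReal.ofReal K * μ (qball ρ x (r / R)) := hdoub x _ (by positivity)
    _ ≤ ENNReal.ofReal K * (ENNReal.ofReal c * μ (qball ρ x (r / R) ∩ Ω)) := by
      gcongr
      exact hdens x hx _ (by positivity) ((div_le_one hR0).2 hrR)
    _ ≤ ENNReal.ofReal (K * c) * μ (qball ρ x r ∩ Ω) := by
      rw [ENNReal.ofReal_mul hK.le, mul_assoc]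
      gcongr
      exact qball_mono (div_le_self hr.le hR)

/-- If all weighted gradients `2^{-j(s-ε)} g_j`, `j ≥ m`, are at most `M` at two points closer
than `2^{-m}`, then `u` oscillates by at most `2^{-mε} · 2M` between them. -/
theorem abs_sub_le_of_weighted_gradient_le {Y : Type*} {ρ : Y → Y → ℝ} (hρ : IsQuasiDist ρ)
    {s ε : ℝ} (hs : 0 < s) (hε : 0 < ε) {u : Y → ℝ} {g : ℤ → Y → ℝ} {z w : Y} {m : ℤ} {M : ℝ}
    (hg : ∀ k, 0 ≤ g k z + g k w)
    (hM : 0 ≤ M) (hlt : ρ z w < (2 : ℝ) ^ (-m))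
    (hgrad : ∀ k : ℤ, (2 : ℝ) ^ (-k - 1) ≤ ρ z w → ρ z w < (2 : ℝ) ^ (-k) →
      |u z - u w| ≤ ρ z w ^ s * (g k z + g k w))
    (hz : ∀ j : ℤ, m ≤ j → (2 : ℝ) ^ (-(j : ℝ) * (s - ε)) * g j z ≤ M)
    (hw : ∀ j : ℤ, m ≤ j → (2 : ℝ) ^ (-(j : ℝ) * (s - ε)) * g j w ≤ M) :
    |u z - u w| ≤ (2 : ℝ) ^ (-(m : ℝ) * ε) * (2 * M) := by
  rcases (hρ.1 z w).eq_or_lt with h0 | h0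
  · rw [(hρ.2.1 z w).1 h0.symm, sub_self, abs_zero]
    positivity
  obtain ⟨n, hn1, hn2⟩ := exists_mem_Ico_zpow (y := (2 : ℝ)) h0 one_lt_two
  obtain ⟨j, rfl⟩ : ∃ j : ℤ, n = -j - 1 := ⟨-n - 1, by ring⟩
  rw [sub_add_cancel] at hn2
  have hmj : m ≤ j := by
    have := (zpow_lt_zpow_iff_right₀ (one_lt_two (α := ℝ))).1 (hn1.trans_lt hlt)
    omega
  have hpow : ρ z w ^ s ≤ (2 : ℝ) ^ (-(j : ℝ) * ε) * (2 : ℝ) ^ (-(j : ℝ) * (s - ε)) := by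
    rw [← Real.rpow_add two_pos, show -(j : ℝ) * ε + -(j : ℝ) * (s - ε) = -(j : ℝ) * s by ring,
      Real.rpow_mul two_pos.le]
    refine Real.rpow_le_rpow h0.le ?_ hs.le
    rw [← Int.cast_neg, Real.rpow_intCast]
    exact hn2.le
  calc |u z - u w| ≤ ρ z w ^ s * (g j z + g j w) := hgrad j hn1 hn2
    _ ≤ ((2 : ℝ) ^ (-(j : ℝ) * ε) * (2 : ℝ) ^ (-(j : ℝ) * (s - ε))) * (g j z + g j w) :=
      mul_le_mul_of_nonneg_right hpow (hg j)
    _ = (2 : ℝ) ^ (-(j : ℝ) * ε) * ((2 : ℝ) ^ (-(j : ℝ) * (s - ε)) * g j z +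
        (2 : ℝ) ^ (-(j : ℝ) * (s - ε)) * g j w) := by ring
    _ ≤ (2 : ℝ) ^ (-(j : ℝ) * ε) * (2 * M) := by
      gcongr
      linarith [hz j hmj, hw j hmj]
    _ ≤ (2 : ℝ) ^ (-(m : ℝ) * ε) * (2 * M) := by
      gcongr
      · exact one_le_two

/-- Chebyshev's inequality in terms of the average `A` over `B`, including the case `A = 0`. -/
theorem mul_measure_gt_le_of_average {μ : Measure X} {B : Set X} {H : X → ℝ≥0∞}
    (hH : AEMeasurable H (μ.restrict B)) (hB : μ B ≠ 0) (hB' : μ B ≠ ∞) (P : ℝ≥0∞)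
    (hA : (∫⁻ z in B, H z ∂μ) / μ B ≠ ∞) :
    P * μ.restrict B {z | P * ((∫⁻ z in B, H z ∂μ) / μ B) < H z} ≤ μ B := by
  set A := (∫⁻ z in B, H z ∂μ) / μ B with hAdef
  have hI : ∫⁻ z in B, H z ∂μ = A * μ B := (ENNReal.div_mul_cancel hB hB').symm
  rcases eq_or_ne A 0 with h0 | h0
  · have hz : ∀ᵐ z ∂μ.restrict B, H z = 0 := by
      rw [h0, zero_mul] at hI
      exact (lintegral_eq_zero_iff' hH).1 hI
    have : μ.restrict B {z | P * A < H z} = 0 := by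
      rw [h0, mul_zero]
      refine measure_mono_null (fun z hz' => ?_) (ae_iff.1 hz)
      exact hz'.ne'
    simp [this]
  · have h1 := mul_meas_ge_le_lintegral₀ hH (P * A)
    rw [hI] at h1
    refine (ENNReal.mul_le_mul_iff_right h0 hA).1 ?_
    refine le_trans ?_ h1
    rw [← mul_assoc, mul_comm A P]
    gcongr
    exact fun hz' => hz'.le

/-- Lemma 3.10(ii): oscillation estimate for median values over comparable balls in terms
of fractional `s`-gradients. -/
theorem median_osc_estimate
    {X : Type*} [MeasurableSpace X] (ρ : X → X → ℝ) (μ : Measure X)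
    (hX : IsQMMS ρ μ) (hdoub : DoublingMeas ρ μ)
    (Ω : Set X) (hΩmeas : MeasurableSet Ω) (hΩne : Ω.Nonempty)
    (hdens : MeasDensity ρ μ Ω)
    (t s ε : ℝ) (ht : 0 < t) (hs : 0 < s) (hε : 0 < ε) (hεs : ε < s)
    (c : ℝ) (hc : 1 ≤ c)
    (k₀ : ℕ) (hk₀ : Crho ρ ^ 2 * CrhoTilde ρ ≤ 2 ^ k₀) :
    ∀ rstar : ℝ, 1 ≤ rstar → ∃ C : ℝ, 0 < C ∧
      ∀ (u : X → ℝ), AEMeasurable u (μ.restrict Ω) →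
      ∀ g ∈ fracGrad ρ μ Ω s u, ∀ x ∈ Ω, ∀ L : ℤ, (2 : ℝ) ^ (-L) ≤ rstar →
      ∀ y ∈ Ω, ∀ rB : ℝ, 0 < rB →
        qball ρ y rB ⊆ qball ρ x ((2 : ℝ) ^ (-L)) →
        μ (qball ρ x ((2 : ℝ) ^ (-L)) ∩ Ω) ≤ ENNReal.ofReal c * μ (qball ρ y rB ∩ Ω) →
        ENNReal.ofReal
            |medianVal μ (qball ρ y rB ∩ Ω) u -
              medianVal μ (qball ρ x ((2 : ℝ) ^ (-L)) ∩ Ω) u| ≤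
          ENNReal.ofReal (C * (2 : ℝ) ^ (-(L : ℝ) * ε)) *
            ((∫⁻ z in qball ρ x (Crho ρ * (2 : ℝ) ^ (-L)),
                (⨆ j : ℤ, ⨆ _ : L - (k₀ : ℤ) ≤ j,
                  ENNReal.ofReal ((2 : ℝ) ^ (-(j : ℝ) * (s - ε) * t) *
                    (Set.indicator Ω (g j) z) ^ t)) ∂μ) /
              μ (qball ρ x (Crho ρ * (2 : ℝ) ^ (-L)))) ^ (1 / t) := by
  intro rstar hrstar
  obtain ⟨K, hK, hdens⟩ := hdens.exists_measure_le hdoub (Crho ρ) hrstar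
  have hρ := hX.quasi
  have hC1 := hρ.one_le_Crho
  have hc0 : 0 < c := by linarith
  refine ⟨4 * (2 : ℝ) ^ ((k₀ : ℝ) * ε) * (4 * c * K) ^ (1 / t), by positivity, ?_⟩
  rintro u - g ⟨hg0, hgm, N, hN, hg⟩ x hx L hL y hy rB - hsub hcomp
  set R : ℝ := (2 : ℝ) ^ (-L) with hRdef
  have hR : 0 < R := by positivity
  have hCR : 0 < Crho ρ * R := by positivity
  set B := qball ρ x (Crho ρ * R) with hBdef
  set E := qball ρ x R ∩ Ω with hEdef
  set F := qball ρ y rB ∩ Ω with hFdef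
  set H : X → ℝ≥0∞ := fun z => ⨆ j : ℤ, ⨆ _ : L - (k₀ : ℤ) ≤ j,
    ENNReal.ofReal ((2 : ℝ) ^ (-(j : ℝ) * (s - ε) * t) * (Set.indicator Ω (g j) z) ^ t) with hHdef
  set A := (∫⁻ z in B, H z ∂μ) / μ B with hAdef
  have hB0 : μ B ≠ 0 := (hX.ball_pos x _ hCR).ne'
  have hBtop : μ B ≠ ∞ := (hX.ball_lt_top x _ hCR).ne
  rcases eq_or_ne A ∞ with hA | hA
  · rw [hA, ENNReal.top_rpow_of_pos (by positivity), ENNReal.mul_top]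
    · exact le_top
    · exact (ENNReal.ofReal_pos.2 (by positivity)).ne'
  have hFE : F ⊆ E := inter_subset_inter_left _ hsub
  have hEB : E ⊆ B := inter_subset_left.trans (qball_mono (by nlinarith))
  have hBE : μ B ≤ ENNReal.ofReal K * μ E := hdens x hx R hR hL
  have hEtop : μ E ≠ ∞ := ne_top_of_le_ne_top hBtop (measure_mono hEB)
  have hFtop : μ F ≠ ∞ := ne_top_of_le_ne_top hEtop (measure_mono hFE)
  have hF0 : μ F ≠ 0 := by
    intro h0
    rw [h0, mul_zero] at hcomp
    rw [le_zero_iff.1 hcomp, mul_zero] at hBE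
    exact hB0 (le_zero_iff.1 hBE)
  have hHm : AEMeasurable H μ :=
    AEMeasurable.iSup fun j => AEMeasurable.iSup fun _ =>
      ((((aemeasurable_indicator_iff hΩmeas).2 (hgm j)).pow_const t).const_mul _).ennreal_ofReal
  set P := ENNReal.ofReal (4 * c * K) with hPdef
  set bad := {z ∈ E | z ∈ N ∨ P * A < H z} with hbaddef
  have hbadF : μ bad < μ F / 2 := by
    have hle : μ bad ≤ μ.restrict B {z | P * A < H z} := calc
      μ bad ≤ μ (N ∪ {z | P * A < H z} ∩ B) := by
        refine measure_mono ?_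
        rintro z ⟨hzE, hzN | hz⟩
        · exact Or.inl hzN
        · exact Or.inr ⟨hz, hEB hzE⟩
      _ ≤ μ N + μ ({z | P * A < H z} ∩ B) := measure_union_le _ _
      _ ≤ μ.restrict B {z | P * A < H z} := by
        rw [hN, zero_add]
        exact Measure.le_restrict_apply _ _
    have hq : ENNReal.ofReal (c * K) * (4 * μ bad) ≤ ENNReal.ofReal (c * K) * μ F := calc
      ENNReal.ofReal (c * K) * (4 * μ bad) = P * μ bad := by
        rw [hPdef, mul_assoc 4 c K, ENNReal.ofReal_mul (by norm_num : (0 : ℝ) ≤ 4),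
          ENNReal.ofReal_ofNat]
        ring
      _ ≤ P * μ.restrict B {z | P * A < H z} := by gcongr
      _ ≤ μ B := mul_measure_gt_le_of_average hHm.restrict hB0 hBtop P hA
      _ ≤ ENNReal.ofReal K * (ENNReal.ofReal c * μ F) := hBE.trans (by gcongr)
      _ = ENNReal.ofReal (c * K) * μ F := by
        rw [ENNReal.ofReal_mul hc0.le]
        ring
    have hq' : 4 * μ bad ≤ μ F :=
      (ENNReal.mul_le_mul_iff_right (ENNReal.ofReal_pos.2 (by positivity)).ne'
        ENNReal.ofReal_ne_top).1 hq
    by_contra! hge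
    have hcontra : 2 * μ F ≤ μ F := calc
      2 * μ F = 4 * (μ F / 2) := by
        rw [show (4 : ℝ≥0∞) = 2 * 2 by norm_num, mul_assoc,
          ENNReal.mul_div_cancel (by simp) (by simp)]
      _ ≤ 4 * μ bad := by gcongr
      _ ≤ μ F := hq'
    rw [two_mul] at hcontra
    exact (ENNReal.lt_add_right hFtop hF0).not_ge hcontra
  obtain ⟨a, haF, ha⟩ : ∃ a ∈ F, a ∉ bad := by
    by_contra! hall
    exact (hbadF.trans_le ENNReal.half_le_self).not_ge (measure_mono hall)
  have haE := hFE haF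
  set M := (4 * c * K * A.toReal) ^ (1 / t) with hMdef
  have hM0 : 0 ≤ M := by positivity
  have hgood : ∀ z ∈ E, z ∉ bad → z ∉ N ∧
      ∀ j : ℤ, L - k₀ ≤ j → (2 : ℝ) ^ (-(j : ℝ) * (s - ε)) * g j z ≤ M := by
    intro z hz hzbad
    have hz' : ¬ (z ∈ N ∨ P * A < H z) := fun h => hzbad ⟨hz, h⟩
    push Not at hz'
    refine ⟨hz'.1, fun j hj => ?_⟩
    have h1 : ENNReal.ofReal ((2 : ℝ) ^ (-(j : ℝ) * (s - ε) * t) *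
        (Set.indicator Ω (g j) z) ^ t) ≤ ENNReal.ofReal (4 * c * K * A.toReal) := by
      rw [ENNReal.ofReal_mul (p := 4 * c * K) (by positivity), ENNReal.ofReal_toReal hA]
      exact (le_iSup₂ (f := fun (j : ℤ) (_ : L - (k₀ : ℤ) ≤ j) =>
        ENNReal.ofReal ((2 : ℝ) ^ (-(j : ℝ) * (s - ε) * t) *
          (Set.indicator Ω (g j) z) ^ t)) j hj).trans hz'.2
    rw [ENNReal.ofReal_le_ofReal_iff (by positivity), Set.indicator_of_mem hz.2,
      Real.rpow_mul two_pos.le, ← Real.mul_rpow (by positivity) (hg0 j z)] at h1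
    rw [hMdef, one_div]
    exact (Real.le_rpow_inv_iff_of_pos (mul_nonneg (by positivity) (hg0 j z))
      (by positivity) ht).2 h1
  set D := (2 : ℝ) ^ (-((L - k₀ : ℤ) : ℝ) * ε) * (2 * M) with hDdef
  have hosc : ∀ z ∈ E, z ∉ bad → |u z - u a| ≤ D := by
    intro z hz hzbad
    obtain ⟨hzN, hzM⟩ := hgood z hz hzbad
    obtain ⟨haN, haM⟩ := hgood a haE ha
    refine abs_sub_le_of_weighted_gradient_le hρ hs hε
      (fun k => add_nonneg (hg0 k z) (hg0 k a)) hM0 ?_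
      (fun k => hg k z ⟨hz.2, hzN⟩ a ⟨haE.2, haN⟩) hzM haM
    calc ρ z a < Crho ρ * CrhoTilde ρ * R := hρ.lt_of_mem_qball hz.1 haE.1
      _ ≤ Crho ρ ^ 2 * CrhoTilde ρ * R := by
        have := hρ.one_le_CrhoTilde
        gcongr
        nlinarith
      _ ≤ 2 ^ k₀ * R := by gcongr
      _ = (2 : ℝ) ^ (-(L - k₀ : ℤ)) := by
        rw [hRdef, ← zpow_natCast, ← zpow_add₀ two_ne_zero]
        congr 1
        ring
  have hdev : ∀ S ⊆ E, {z ∈ S | ¬ |u z - u a| ≤ D} ⊆ bad := by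
    rintro S hS z ⟨hz, hzD⟩
    by_contra hzbad
    exact hzD (hosc z (hS hz) hzbad)
  have hmF : |medianVal μ F u - u a| ≤ D :=
    abs_medianVal_sub_le hFtop ((measure_mono (hdev F hFE)).trans_lt hbadF)
  have hmE : |medianVal μ E u - u a| ≤ D :=
    abs_medianVal_sub_le hEtop (((measure_mono (hdev E subset_rfl)).trans_lt hbadF).trans_le
      (ENNReal.div_le_div_right (measure_mono hFE) 2))
  have hdiff : |medianVal μ F u - medianVal μ E u| ≤ 2 * D := by
    rw [abs_le] at *
    constructor <;> linarith [hmF.1, hmF.2, hmE.1, hmE.2]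
  have hconst : 2 * D = 4 * (2 : ℝ) ^ ((k₀ : ℝ) * ε) * (4 * c * K) ^ (1 / t) *
      (2 : ℝ) ^ (-(L : ℝ) * ε) * A.toReal ^ (1 / t) := by
    rw [hDdef, hMdef, Real.mul_rpow (by positivity) (by positivity),
      show -((L - k₀ : ℤ) : ℝ) * ε = (k₀ : ℝ) * ε + -(L : ℝ) * ε by push_cast; ring,
      Real.rpow_add two_pos]
    ring
  calc ENNReal.ofReal |medianVal μ F u - medianVal μ E u| ≤ ENNReal.ofReal (2 * D) :=
        ENNReal.ofReal_le_ofReal hdiff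
    _ = _ := by
      rw [hconst, ENNReal.ofReal_mul (by positivity),
        ← ENNReal.ofReal_rpow_of_nonneg (by positivity) (by positivity),
        ENNReal.ofReal_toReal hA]

end HajlaszPaper
end
end
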